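/- Let φ : ℝ^d × 𝕀 → ℝ be smooth and 1-periodic in x. Then there exists a unique function Φ : ℝ^d × 𝕀 → ℝ with Φ(·,α) ∈ C² for each α ∈ 𝕀, solving ℒΦ(x,α) = φ(x,α) for all (x,α) ∈ ℝ^d × 𝕀, with Φ 1-periodic in x and ∑_{α=1}^{𝚖} ∫_{𝕋^d} Φ(x,α) dx = 0, if and only if the centering condition ∑_{α=1}^{𝚖} ∫_{𝕋^d} φ(x,α) m(x,α) dx = 0 holds. -/

import Mathlib

open MeasureTheory Matrix Finset

noncomputable section

/-- Partial derivative `∂f/∂x_j` of a function on `ℝ^d`. -/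
def pd {d : ℕ} (f : (Fin d → ℝ) → ℝ) (j : Fin d) (x : Fin d → ℝ) : ℝ :=
  fderiv ℝ f x (Pi.single j 1)

/-- Second partial derivative `∂²f/∂x_j∂x_k`. -/
def pd2 {d : ℕ} (f : (Fin d → ℝ) → ℝ) (j k : Fin d) (x : Fin d → ℝ) : ℝ :=
  pd (fun y => pd f j y) k x

/-- `1`-periodicity of a function on `ℝ^d`. -/
def Per {d : ℕ} (f : (Fin d → ℝ) → ℝ) : Prop :=
  ∀ (x : Fin d → ℝ) (ν : Fin d → ℤ), f (x + fun i => (ν i : ℝ)) = f x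

/-- Integral over the fundamental domain `[0,1)^d` of the torus `𝕋^d`. -/
def tInt {d : ℕ} (f : (Fin d → ℝ) → ℝ) : ℝ :=
  ∫ x in Set.pi Set.univ (fun _ : Fin d => Set.Ico (0:ℝ) 1), f x

/-- Diffusion matrix `a(x,α) = σ(x,α) σ(x,α)ᵀ`. -/
def diffMat {d r m : ℕ} (σ : (Fin d → ℝ) → Fin m → Matrix (Fin d) (Fin r) ℝ)
    (x : Fin d → ℝ) (α : Fin m) : Matrix (Fin d) (Fin d) ℝ :=
  σ x α * (σ x α)ᵀ

/-- The jump part `Qf(x,α) = ∑_{β ≠ α} q_{αβ}(x) [f(x,β) - f(x,α)]` of the generator. -/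
def jumpOp {d m : ℕ} (q : Fin m → Fin m → (Fin d → ℝ) → ℝ)
    (f : (Fin d → ℝ) → Fin m → ℝ) (x : Fin d → ℝ) (α : Fin m) : ℝ :=
  ∑ β ∈ Finset.univ.filter (fun β => β ≠ α), q α β x * (f x β - f x α)

/-- The generator `ℒ` of the switching diffusion. -/
def gen {d m : ℕ} (b : (Fin d → ℝ) → Fin m → Fin d → ℝ)
    (a : (Fin d → ℝ) → Fin m → Matrix (Fin d) (Fin d) ℝ)
    (q : Fin m → Fin m → (Fin d → ℝ) → ℝ)
    (f : (Fin d → ℝ) → Fin m → ℝ) (x : Fin d → ℝ) (α : Fin m) : ℝ :=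
  (∑ j, b x α j * pd (fun y => f y α) j x)
    + (1/2) * ∑ j, ∑ k, a x α j k * pd2 (fun y => f y α) j k x
    + jumpOp q f x α

/-- The formal `L²`-adjoint `ℒ*`; its jump part uses the transposed intensity matrix and
includes the diagonal term. -/
def genAdj {d m : ℕ} (b : (Fin d → ℝ) → Fin m → Fin d → ℝ)
    (a : (Fin d → ℝ) → Fin m → Matrix (Fin d) (Fin d) ℝ)
    (q : Fin m → Fin m → (Fin d → ℝ) → ℝ)
    (g : (Fin d → ℝ) → Fin m → ℝ) (x : Fin d → ℝ) (α : Fin m) : ℝ :=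
  -(∑ j, pd (fun y => b y α j * g y α) j x)
    + (1/2) * ∑ j, ∑ k, pd2 (fun y => a y α j k * g y α) j k x
    + ∑ β, q β α x * g x β

section Part1
open MeasureTheory Matrix Finset
/-- The fundamental cube. -/
def cube (d : ℕ) : Set (Fin d → ℝ) := Set.pi Set.univ (fun _ : Fin d => Set.Ico (0:ℝ) 1)

lemma cube_sub (d : ℕ) : cube d ⊆ Set.Icc 0 1 := by
  intro x hx
  exact ⟨fun i => (hx i trivial).1, fun i => (hx i trivial).2.le⟩

lemma cube_meas (d : ℕ) : MeasurableSet (cube d) :=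
  MeasurableSet.univ_pi fun _ => measurableSet_Ico

lemma cube_vol (d : ℕ) : volume (cube d) = 1 := by
  rw [cube, volume_pi_pi]; simp

lemma cube_integrable {d : ℕ} {f : (Fin d → ℝ) → ℝ} (hf : Continuous f) :
    IntegrableOn f (cube d) :=
  (hf.continuousOn.integrableOn_compact isCompact_Icc).mono_set (cube_sub d)

lemma tInt_def {d : ℕ} (f : (Fin d → ℝ) → ℝ) : tInt f = ∫ x in cube d, f x := rfl

lemma tInt_add {d : ℕ} {f g : (Fin d → ℝ) → ℝ} (hf : Continuous f) (hg : Continuous g) :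
    tInt (fun x => f x + g x) = tInt f + tInt g :=
  integral_add (cube_integrable hf) (cube_integrable hg)

lemma tInt_sub {d : ℕ} {f g : (Fin d → ℝ) → ℝ} (hf : Continuous f) (hg : Continuous g) :
    tInt (fun x => f x - g x) = tInt f - tInt g :=
  integral_sub (cube_integrable hf) (cube_integrable hg)

lemma tInt_const_mul {d : ℕ} (c : ℝ) (f : (Fin d → ℝ) → ℝ) :
    tInt (fun x => c * f x) = c * tInt f :=
  integral_const_mul c _

lemma tInt_sum {d : ℕ} {ι : Type*} (s : Finset ι) {f : ι → (Fin d → ℝ) → ℝ}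
    (hf : ∀ i, Continuous (f i)) :
    tInt (fun x => ∑ i ∈ s, f i x) = ∑ i ∈ s, tInt (f i) :=
  integral_finsetSum s fun i _ => cube_integrable (hf i)

lemma tInt_const {d : ℕ} (c : ℝ) : tInt (fun _ : Fin d → ℝ => c) = c := by
  rw [tInt_def, setIntegral_const, measureReal_def, cube_vol]; simp

lemma tInt_mono {d : ℕ} {f g : (Fin d → ℝ) → ℝ} (hf : Continuous f) (hg : Continuous g)
    (h : ∀ x, f x ≤ g x) : tInt f ≤ tInt g :=
  integral_mono (cube_integrable hf) (cube_integrable hg) h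

lemma tInt_nonneg {d : ℕ} {f : (Fin d → ℝ) → ℝ}
    (h : ∀ x, 0 ≤ f x) : 0 ≤ tInt f :=
  integral_nonneg h

lemma per_insertNth {n : ℕ} {f : (Fin (n+1) → ℝ) → ℝ} (hp : Per f) (j : Fin (n+1))
    (x : Fin n → ℝ) : f (j.insertNth 1 x) = f (j.insertNth 0 x) := by
  rw [← hp (j.insertNth (0:ℝ) x) (Pi.single j 1)]
  congr 1
  ext i
  refine Fin.succAboveCases j ?_ ?_ i
  · simp
  · intro i; simp

lemma tInt_pd {d : ℕ} {f : (Fin d → ℝ) → ℝ} (hf : ContDiff ℝ 1 f) (hp : Per f) (j : Fin d) :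
    tInt (pd f j) = 0 := by
  obtain _ | n := d
  · exact j.elim0
  have hc : Continuous (pd f j) := by
    unfold pd
    exact (hf.continuous_fderiv (by norm_num)).clm_apply continuous_const
  have key := integral_divergence_of_hasFDerivAt_off_countable' (E := ℝ) (n := n) 0 1
    (by intro i; simp)
    (fun i => if i = j then f else 0) (fun i x => if i = j then fderiv ℝ f x else 0) ∅
    Set.countable_empty
    (by intro i; split_ifs
        · exact hf.continuous.continuousOn
        · exact continuousOn_const)
    (by intro x _ i; split_ifs
        · exact (hf.differentiable (by norm_num) x).hasFDerivAt
        · exact hasFDerivAt_const _ _)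
    (by
      have : (fun x => ∑ i, (if i = j then fderiv ℝ f x else 0) (Pi.single i (1:ℝ))) = pd f j := by
        ext x
        rw [Finset.sum_eq_single j]
        · simp [pd]
        · intro i _ hi; simp [hi]
        · simp
      rw [this]
      exact hc.continuousOn.integrableOn_compact isCompact_Icc)
  have h1 : (fun x => ∑ i, (if i = j then fderiv ℝ f x else 0) (Pi.single i (1:ℝ))) = pd f j := by
    ext x
    rw [Finset.sum_eq_single j]
    · simp [pd]
    · intro i _ hi; simp [hi]
    · simp
  have h2 : tInt (pd f j) = ∫ x in Set.Icc (0 : Fin (n+1) → ℝ) 1, pd f j x := by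
    unfold tInt
    rw [volume_pi]
    exact setIntegral_congr_set Measure.univ_pi_Ico_ae_eq_Icc
  rw [h2]
  simp only [h1] at key
  rw [show (∫ x in Set.Icc (0 : Fin (n+1) → ℝ) 1, pd f j x) = _ from key]
  apply Finset.sum_eq_zero
  intro i _
  by_cases hi : i = j
  · subst hi
    simp only [if_true, Pi.one_apply, Pi.zero_apply]
    simp_rw [per_insertNth hp]
    exact sub_self _
  · simp [hi]

lemma pd_add {d : ℕ} {f g : (Fin d → ℝ) → ℝ} {x} (hf : DifferentiableAt ℝ f x)
    (hg : DifferentiableAt ℝ g x) (j : Fin d) :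
    pd (fun y => f y + g y) j x = pd f j x + pd g j x := by
  unfold pd; rw [fderiv_fun_add hf hg]; rfl

lemma pd_sub {d : ℕ} {f g : (Fin d → ℝ) → ℝ} {x} (hf : DifferentiableAt ℝ f x)
    (hg : DifferentiableAt ℝ g x) (j : Fin d) :
    pd (fun y => f y - g y) j x = pd f j x - pd g j x := by
  unfold pd; rw [fderiv_fun_sub hf hg]; rfl

lemma pd_mul {d : ℕ} {f g : (Fin d → ℝ) → ℝ} {x} (hf : DifferentiableAt ℝ f x)
    (hg : DifferentiableAt ℝ g x) (j : Fin d) :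
    pd (fun y => f y * g y) j x = f x * pd g j x + g x * pd f j x := by
  unfold pd; rw [fderiv_fun_mul hf hg]; simp

lemma pd_const_mul {d : ℕ} {f : (Fin d → ℝ) → ℝ} {x} (hf : DifferentiableAt ℝ f x) (c : ℝ)
    (j : Fin d) : pd (fun y => c * f y) j x = c * pd f j x := by
  unfold pd; rw [fderiv_const_mul hf]; simp

lemma pd_const {d : ℕ} (c : ℝ) (j : Fin d) (x) : pd (fun _ : Fin d → ℝ => c) j x = 0 := by
  unfold pd; simp

lemma pd_contDiff {d : ℕ} {f : (Fin d → ℝ) → ℝ} {n k : WithTop ℕ∞} (hf : ContDiff ℝ n f)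
    (h : k + 1 ≤ n) (j : Fin d) : ContDiff ℝ k (pd f j) := by
  unfold pd
  exact (hf.fderiv_right h).clm_apply contDiff_const

lemma pd_per {d : ℕ} {f : (Fin d → ℝ) → ℝ} (hp : Per f) (j : Fin d) : Per (pd f j) := by
  intro x ν
  unfold pd
  have h : (fun y => f (y + fun i => (ν i : ℝ))) = f := by ext y; exact hp y ν
  conv_rhs => rw [← h]
  rw [fderiv_comp_add_right]

lemma pd_comm {d : ℕ} {f : (Fin d → ℝ) → ℝ} (hf : ContDiff ℝ 2 f) (i j : Fin d) (x) :
    pd (pd f i) j x = pd (pd f j) i x := by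
  have hs : IsSymmSndFDerivAt ℝ f x := hf.contDiffAt.isSymmSndFDerivAt (by simp)
  have hd : DifferentiableAt ℝ (fderiv ℝ f) x :=
    (hf.fderiv_right (m := 1) (by norm_num)).differentiable (by norm_num) x
  have key : ∀ i j : Fin d, pd (pd f i) j x
      = fderiv ℝ (fderiv ℝ f) x (Pi.single j 1) (Pi.single i 1) := by
    intro i j
    unfold pd
    rw [fderiv_clm_apply hd (differentiableAt_const _)]
    simp
  rw [key, key, hs.eq]

lemma per_mul {d : ℕ} {f g : (Fin d → ℝ) → ℝ} (hf : Per f) (hg : Per g) :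
    Per (fun x => f x * g x) := fun x ν => by
  show f _ * g _ = _
  rw [hf, hg]

/-- Reduction to the cube. -/
lemma per_fract {d : ℕ} {f : (Fin d → ℝ) → ℝ} (hp : Per f) (x : Fin d → ℝ) :
    f (fun i => Int.fract (x i)) = f x := by
  rw [← hp (fun i => Int.fract (x i)) (fun i => ⌊x i⌋)]
  congr 1
  ext i
  simp [Int.fract_add_floor]

lemma fract_mem_cube {d : ℕ} (x : Fin d → ℝ) : (fun i => Int.fract (x i)) ∈ cube d :=
  fun _ _ => ⟨Int.fract_nonneg _, Int.fract_lt_one _⟩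

lemma per_bdd {d : ℕ} {f : (Fin d → ℝ) → ℝ} (hp : Per f) (hf : Continuous f) :
    ∃ C, 0 ≤ C ∧ ∀ x, |f x| ≤ C := by
  obtain ⟨C, hC⟩ := (isCompact_Icc (a := (0 : Fin d → ℝ)) (b := 1)).exists_bound_of_continuousOn
    hf.continuousOn
  refine ⟨max C 0, le_max_right _ _, fun x => ?_⟩
  rw [← per_fract hp x]
  exact (hC _ (cube_sub d (fract_mem_cube x))).trans (le_max_left _ _)

/-- A nonnegative continuous periodic function with zero integral vanishes. -/
lemma tInt_eq_zero {d : ℕ} {f : (Fin d → ℝ) → ℝ} (hp : Per f) (hf : Continuous f)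
    (h0 : ∀ x, 0 ≤ f x) (hI : tInt f = 0) (x) : f x = 0 := by
  rw [tInt_def, setIntegral_eq_zero_iff_of_nonneg_ae (Filter.Eventually.of_forall h0)
    (cube_integrable hf)] at hI
  have h1 : f =ᵐ[volume.restrict (Set.pi Set.univ fun _ : Fin d => Set.Ioo (0:ℝ) 1)] 0 :=
    ae_restrict_of_ae_restrict_of_subset
      (Set.pi_mono fun _ _ => Set.Ioo_subset_Ico_self) hI
  have h2 : Set.EqOn f 0 (Set.pi Set.univ fun _ : Fin d => Set.Ioo (0:ℝ) 1) :=
    Measure.eqOn_open_of_ae_eq h1 (isOpen_set_pi Set.finite_univ fun _ _ => isOpen_Ioo)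
      hf.continuousOn continuousOn_const
  have h3 : Set.EqOn f 0 (closure (Set.pi Set.univ fun _ : Fin d => Set.Ioo (0:ℝ) 1)) :=
    h2.closure hf continuous_const
  rw [← per_fract hp x]
  apply h3
  rw [closure_pi_set]
  intro _ _
  rw [closure_Ioo (by norm_num)]
  exact ⟨Int.fract_nonneg _, (Int.fract_lt_one _).le⟩

end Part1

section Part2
open MeasureTheory Matrix Finset
lemma two_le_inf : (2 : WithTop ℕ∞) ≤ ((⊤ : ℕ∞) : WithTop ℕ∞) :=
  WithTop.coe_le_coe.2 (le_top : (2:ℕ∞) ≤ ⊤)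

/-- The algebra of smooth `1`-periodic functions. -/
def SP (d : ℕ) : Subalgebra ℝ ((Fin d → ℝ) → ℝ) where
  carrier := {f | ContDiff ℝ (⊤ : ℕ∞) f ∧ Per f}
  mul_mem' := fun hf hg => ⟨hf.1.mul hg.1, per_mul hf.2 hg.2⟩
  add_mem' := fun {f g} hf hg => ⟨hf.1.add hg.1, fun x ν => by
    show f _ + g _ = f _ + g _
    rw [hf.2, hg.2]⟩
  algebraMap_mem' := fun _ => ⟨contDiff_const, fun _ _ => rfl⟩

namespace SP
variable {d : ℕ}

instance : CoeFun (SP d) (fun _ => (Fin d → ℝ) → ℝ) := ⟨fun f => f.1⟩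

lemma smooth (u : SP d) : ContDiff ℝ (⊤ : ℕ∞) u.1 := u.2.1
lemma per (u : SP d) : Per u.1 := u.2.2
lemma cont (u : SP d) : Continuous u.1 := u.2.1.continuous
lemma diff (u : SP d) : Differentiable ℝ u.1 := u.2.1.differentiable (by simp)

@[simp] lemma add_app (u v : SP d) (x) : (u + v) x = u x + v x := rfl
@[simp] lemma sub_app (u v : SP d) (x) : (u - v) x = u x - v x := rfl
@[simp] lemma neg_app (u : SP d) (x) : (-u) x = - u x := rfl
@[simp] lemma mul_app (u v : SP d) (x) : (u * v) x = u x * v x := rfl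
@[simp] lemma smul_app (c : ℝ) (v : SP d) (x) : (c • v) x = c * v x := rfl
@[simp] lemma zero_app (x) : (0 : SP d) x = 0 := rfl
@[simp] lemma one_app (x) : (1 : SP d) x = 1 := rfl
lemma sum_app {ι : Type*} (s : Finset ι) (u : ι → SP d) (x) :
    (∑ i ∈ s, u i) x = ∑ i ∈ s, u i x := by
  classical
  induction s using Finset.induction_on with
  | empty => simp
  | insert i s hi ih => rw [Finset.sum_insert hi, Finset.sum_insert hi, add_app, ih]

lemma ext' {u v : SP d} (h : ∀ x, u x = v x) : u = v := Subtype.ext (funext h)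

/-- Partial derivative on smooth periodic functions. -/
def D (j : Fin d) : SP d →ₗ[ℝ] SP d where
  toFun u := ⟨pd u.1 j, pd_contDiff (smooth u) (by simp) j, pd_per (per u) j⟩
  map_add' u v := ext' fun x => pd_add ((diff u) x) ((diff v) x) j
  map_smul' c u := ext' fun x => pd_const_mul ((diff u) x) c j

lemma D_app (j : Fin d) (u : SP d) (x) : D j u x = pd u.1 j x := rfl

lemma D_mul (j : Fin d) (u v : SP d) : D j (u * v) = u * D j v + v * D j u :=
  ext' fun x => pd_mul ((diff u) x) ((diff v) x) j

lemma D_one (j : Fin d) : D j 1 = 0 := ext' fun x => pd_const 1 j x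

lemma D_comm (i j : Fin d) (u : SP d) : D i (D j u) = D j (D i u) :=
  ext' fun x => pd_comm ((smooth u).of_le two_le_inf) j i x

/-- The integral. -/
def I : SP d →ₗ[ℝ] ℝ where
  toFun u := tInt u.1
  map_add' u v := tInt_add (cont u) (cont v)
  map_smul' c _ := tInt_const_mul c _

lemma I_def (u : SP d) : I u = tInt u.1 := rfl

lemma I_D (j : Fin d) (u : SP d) : I (D j u) = 0 :=
  tInt_pd ((smooth u).of_le (by exact_mod_cast le_top)) (per u) j

lemma I_nonneg {u : SP d} (h : ∀ x, 0 ≤ u x) : 0 ≤ I u := tInt_nonneg h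

lemma I_mono {u v : SP d} (h : ∀ x, u x ≤ v x) : I u ≤ I v := tInt_mono (cont u) (cont v) h

lemma I_parts (j : Fin d) (u v : SP d) : I (u * D j v) = - I (v * D j u) := by
  have := I_D j (u * v)
  rw [D_mul, map_add] at this
  linarith

/-- Sobolev inner products. -/
def ip : ℕ → (SP d →ₗ[ℝ] SP d →ₗ[ℝ] ℝ)
  | 0 => (LinearMap.mul ℝ (SP d)).compr₂ I
  | k+1 => (LinearMap.mul ℝ (SP d)).compr₂ I + ∑ j, (ip k).compl₁₂ (D j) (D j)

lemma ip_zero (u v : SP d) : ip 0 u v = I (u * v) := rfl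
lemma ip_succ (k : ℕ) (u v : SP d) :
    ip (k+1) u v = ip 0 u v + ∑ j, ip k (D j u) (D j v) := by
  simp [ip, LinearMap.sum_apply]

/-- Squared Sobolev norm. -/
def N (k : ℕ) (u : SP d) : ℝ := ip k u u

lemma N_zero (u : SP d) : N 0 u = I (u * u) := rfl
lemma N_succ (k : ℕ) (u : SP d) : N (k+1) u = N 0 u + ∑ j, N k (D j u) := ip_succ k u u

lemma ip_symm (k : ℕ) (u v : SP d) : ip k u v = ip k v u := by
  induction k generalizing u v with
  | zero => rw [ip_zero, ip_zero, mul_comm]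
  | succ k ih => simp only [ip_succ, ih (D _ u)]; rw [ip_zero, ip_zero, mul_comm]

lemma N_nonneg (k : ℕ) (u : SP d) : 0 ≤ N k u := by
  induction k generalizing u with
  | zero => exact I_nonneg fun x => mul_self_nonneg _
  | succ k ih => rw [N_succ]; exact add_nonneg (I_nonneg fun x => mul_self_nonneg _)
                  (Finset.sum_nonneg fun j _ => ih _)

lemma N_mono1 (k : ℕ) (u : SP d) : N k u ≤ N (k+1) u := by
  induction k generalizing u with
  | zero => rw [N_succ]; exact le_add_of_nonneg_right (Finset.sum_nonneg fun j _ => N_nonneg _ _)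
  | succ k ih =>
    rw [N_succ, N_succ (k+1)]
    gcongr with j
    exact ih _

lemma N_mono {k l : ℕ} (h : k ≤ l) (u : SP d) : N k u ≤ N l u := by
  induction h with
  | refl => rfl
  | step _ ih => exact ih.trans (N_mono1 _ _)

lemma N_D (k : ℕ) (j : Fin d) (u : SP d) : N k (D j u) ≤ N (k+1) u := by
  rw [N_succ]
  have := Finset.single_le_sum (f := fun j => N k (D j u)) (fun j _ => N_nonneg _ _)
    (Finset.mem_univ j)
  have h0 := N_nonneg 0 u
  linarith

lemma N_smul (k : ℕ) (c : ℝ) (u : SP d) : N k (c • u) = c^2 * N k u := by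
  simp only [N, map_smul, LinearMap.smul_apply, smul_eq_mul]; ring

lemma young (k : ℕ) {ε : ℝ} (hε : 0 < ε) (u v : SP d) :
    ip k u v ≤ ε * N k u + 1/(4*ε) * N k v := by
  have h := N_nonneg k ((2*ε) • u - v)
  have h2 : N k ((2*ε) • u - v) = 4*ε^2 * N k u - 4 * ε * ip k u v + N k v := by
    simp only [N, map_sub, map_smul, LinearMap.sub_apply, LinearMap.smul_apply, smul_eq_mul]
    rw [ip_symm k v u]; ring
  rw [h2] at h
  have h3 : ip k u v = (1/(4*ε)) * (4*ε*ip k u v) := by field_simp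
  have h4 : ε * N k u + 1/(4*ε) * N k v = (1/(4*ε)) * (4*ε^2*N k u + N k v) := by field_simp
  rw [h3, h4]
  gcongr
  linarith

lemma N_add_le (k : ℕ) (u v : SP d) : N k (u + v) ≤ 2 * N k u + 2 * N k v := by
  have h := N_nonneg k (u - v)
  simp only [N, map_sub, map_add, LinearMap.sub_apply, LinearMap.add_apply] at *
  linarith

lemma sup_bdd (f : SP d) : ∃ C, 0 ≤ C ∧ ∀ x, |f x| ≤ C := per_bdd (per f) (cont f)

lemma N_mul (k : ℕ) (f : SP d) : ∃ C, 0 ≤ C ∧ ∀ u, N k (f * u) ≤ C * N k u := by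
  induction k generalizing f with
  | zero =>
    obtain ⟨C, hC0, hC⟩ := sup_bdd f
    refine ⟨C^2, sq_nonneg _, fun u => ?_⟩
    have : C^2 * N 0 u = I (C^2 • (u * u)) := by rw [map_smul]; rfl
    rw [this, N_zero]
    refine I_mono fun x => ?_
    simp only [mul_app, smul_app]
    have h1 : (f x)^2 ≤ C^2 := by
      rw [← sq_abs]; exact pow_le_pow_left₀ (abs_nonneg _) (hC x) 2
    nlinarith [mul_le_mul_of_nonneg_right h1 (mul_self_nonneg (u x))]
  | succ k ih =>
    obtain ⟨C1, hC1, h1⟩ := ih f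
    choose C2 hC2 h2 using fun j => ih (D j f)
    obtain ⟨C0, hC0, h0⟩ := (show ∃ C, 0 ≤ C ∧ ∀ u, N 0 (f * u) ≤ C * N 0 u by
      obtain ⟨C, hC0, hC⟩ := sup_bdd f
      refine ⟨C^2, sq_nonneg _, fun u => ?_⟩
      have : C^2 * N 0 u = I (C^2 • (u * u)) := by rw [map_smul]; rfl
      rw [this, N_zero]
      refine I_mono fun x => ?_
      simp only [mul_app, smul_app]
      have h1 : (f x)^2 ≤ C^2 := by
        rw [← sq_abs]; exact pow_le_pow_left₀ (abs_nonneg _) (hC x) 2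
      nlinarith [mul_le_mul_of_nonneg_right h1 (mul_self_nonneg (u x))])
    refine ⟨C0 + ∑ j, (2 * C1 + 2 * C2 j), add_nonneg hC0 (Finset.sum_nonneg fun j _ => by
      have := hC2 j; positivity), fun u => ?_⟩
    rw [N_succ, add_mul, Finset.sum_mul]
    refine add_le_add ((h0 u).trans (mul_le_mul_of_nonneg_left (N_mono (Nat.zero_le _) u) hC0))
      (Finset.sum_le_sum fun j _ => ?_)
    rw [D_mul]
    refine (N_add_le _ _ _).trans ?_
    have a1 := (h1 (D j u)).trans (mul_le_mul_of_nonneg_left (N_D k j u) hC1)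
    have a2 : N k (u * D j f) ≤ C2 j * N (k+1) u := by
      rw [mul_comm]
      exact (h2 j u).trans (mul_le_mul_of_nonneg_left (N_mono1 k u) (hC2 j))
    linarith

/-- Lower-order term control. -/
lemma ip_lo (k : ℕ) (f : SP d) {ε : ℝ} (hε : 0 < ε) :
    ∃ C, 0 ≤ C ∧ ∀ u v, ip k (f * u) v ≤ ε * N k u + C * N k v := by
  obtain ⟨C, hC, h⟩ := N_mul k f
  have hδ : 0 < ε / (C + 1) := by positivity
  refine ⟨1/(4*(ε/(C+1))), by positivity, fun u v => (young k hδ _ _).trans (add_le_add ?_ le_rfl)⟩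
  calc ε / (C+1) * N k (f * u) ≤ ε / (C+1) * (C * N k u) := by gcongr; exact h u
    _ ≤ ε / (C+1) * ((C+1) * N k u) := by
        have := N_nonneg k u
        gcongr; linarith
    _ = ε * N k u := by field_simp

lemma ip_one (k : ℕ) (v : SP d) : ip k 1 v = I v := by
  cases k with
  | zero => rw [ip_zero, one_mul]
  | succ k => rw [ip_succ, ip_zero, one_mul]; simp [D_one]

lemma interp0 {δ : ℝ} (hδ : 0 < δ) (j : Fin d) (u : SP d) :
    N 0 (D j u) ≤ δ * N 0 (D j (D j u)) + 1/(4*δ) * N 0 u := by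
  have h : N 0 (D j u) = ip 0 (D j (D j u)) (-u) := by
    rw [N_zero, I_parts, map_neg, ip_zero, mul_comm]
  have h2 : N 0 (-u) = N 0 u := by simp [N]
  rw [h, ← h2]
  exact young 0 hδ _ _

lemma interp (k : ℕ) {ε : ℝ} (hε : 0 < ε) :
    ∃ C, 0 ≤ C ∧ ∀ u : SP d, N k u ≤ ε * ∑ j, N k (D j u) + C * N 0 u := by
  induction k generalizing ε with
  | zero =>
    refine ⟨1, zero_le_one, fun u => ?_⟩
    have : 0 ≤ ∑ j, N 0 (D j u) := Finset.sum_nonneg fun j _ => N_nonneg _ _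
    nlinarith
  | succ k ih =>
    obtain ⟨C, hC, h⟩ := ih (half_pos hε)
    have hδ : 0 < ε / (2 * (C + 1)) := by positivity
    refine ⟨1 + ∑ _j : Fin d, C * (1/(4*(ε / (2 * (C + 1))))), by positivity, fun u => ?_⟩
    rw [N_succ, add_mul, one_mul, add_left_comm, Finset.mul_sum, Finset.sum_mul,
      ← Finset.sum_add_distrib]
    gcongr with j
    have e1 := h (D j u)
    have e2 := mul_le_mul_of_nonneg_left (interp0 hδ j u) hC
    have e3 : ∑ i, N k (D i (D j u)) ≤ N (k+1) (D j u) := by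
      rw [N_succ]; exact le_add_of_nonneg_left (N_nonneg _ _)
    have e4 : N 0 (D j (D j u)) ≤ N (k+1) (D j u) :=
      (N_D 0 j _).trans (N_mono (by omega) _)
    have e5 : C * (ε / (2 * (C+1)) * N 0 (D j (D j u))) ≤ ε/2 * N (k+1) (D j u) := by
      calc _ ≤ (C+1) * (ε / (2 * (C+1)) * N (k+1) (D j u)) := by
            have := N_nonneg 0 (D j (D j u))
            gcongr; linarith
        _ = _ := by field_simp
    have e6 := mul_le_mul_of_nonneg_left e3 (half_pos hε).le
    linarith
end SP

end Part2

section Part3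
open MeasureTheory Matrix Finset
namespace SP
variable {d : ℕ}

/-- Principal part. -/
def Pr (a : Fin d → Fin d → SP d) (u : SP d) : SP d := ∑ j, ∑ k, a j k * D k (D j u)

lemma ip_Pr (a : Fin d → Fin d → SP d) (k : ℕ) (u v : SP d) :
    ip k (Pr a u) v = ∑ j, ∑ l, ip k (a j l * D l (D j u)) v := by
  simp [Pr, LinearMap.sum_apply]

lemma garding_base (a : Fin d → Fin d → SP d) {amin c : ℝ} (hc : c < amin)
    (hell : ∀ (x ξ : Fin d → ℝ), amin * ∑ i, ξ i ^ 2 ≤ ∑ j, ∑ k, a j k x * (ξ j * ξ k)) :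
    ∃ C, 0 ≤ C ∧ ∀ u, ip 0 (Pr a u) u ≤ -c * ∑ j, N 0 (D j u) + C * N 0 u := by
  have hε : 0 < (amin - c) / (d + 1) := div_pos (sub_pos.2 hc) (by positivity)
  choose C hC h using fun j l => ip_lo 0 (- D l (a j l)) hε
  refine ⟨∑ j, ∑ l, C j l, Finset.sum_nonneg fun j _ => Finset.sum_nonneg fun l _ => hC j l,
    fun u => ?_⟩
  rw [ip_Pr]
  have e1 : ∀ j l, ip 0 (a j l * D l (D j u)) u
      = - I (a j l * (D j u * D l u)) + ip 0 (- D l (a j l) * D j u) u := by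
    intro j l
    rw [ip_zero, ip_zero, show a j l * D l (D j u) * u = (a j l * u) * D l (D j u) by ring,
      I_parts, D_mul,
      show D j u * (a j l * D l u + u * D l (a j l))
        = a j l * (D j u * D l u) - (- D l (a j l) * D j u * u) by ring, map_sub]
    ring
  have e2 : amin * ∑ j, N 0 (D j u) ≤ ∑ j, ∑ l, I (a j l * (D j u * D l u)) := by
    have h1 : amin * ∑ j, N 0 (D j u) = I (amin • ∑ j, D j u * D j u) := by
      simp [N_zero]
    have h2 : ∑ j, ∑ l, I (a j l * (D j u * D l u)) = I (∑ j, ∑ l, a j l * (D j u * D l u)) := by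
      simp
    rw [h1, h2]
    refine I_mono fun x => ?_
    have := hell x (fun j => D j u x)
    simp only [sum_app, smul_app, mul_app]
    simpa [sq] using this
  have e3 : ∑ j, ∑ l, ip 0 (- D l (a j l) * D j u) u
      ≤ ∑ j, ∑ l : Fin d, ((amin - c) / (d + 1) * N 0 (D j u) + C j l * N 0 u) :=
    Finset.sum_le_sum fun j _ => Finset.sum_le_sum fun l _ => h j l _ _
  have e4 : ∑ j, ∑ l : Fin d, ((amin - c) / (d + 1) * N 0 (D j u) + C j l * N 0 u)
      = (d * ((amin - c) / (d + 1))) * ∑ j, N 0 (D j u) + (∑ j, ∑ l, C j l) * N 0 u := by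
    simp only [Finset.sum_add_distrib, Finset.sum_const, Finset.card_univ, Fintype.card_fin,
      nsmul_eq_mul, Finset.sum_mul, Finset.mul_sum, mul_assoc]
  have e5 : (d * ((amin - c) / (d + 1))) ≤ amin - c := by
    rw [mul_div_assoc', div_le_iff₀ (by positivity)]
    nlinarith
  have e6 := mul_le_mul_of_nonneg_right e5
    (Finset.sum_nonneg fun (j : Fin d) (_ : j ∈ Finset.univ) => N_nonneg 0 (D j u))
  simp only [e1, Finset.sum_add_distrib, Finset.sum_neg_distrib]
  linarith

lemma D_Pr (a : Fin d → Fin d → SP d) (i : Fin d) (u : SP d) :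
    D i (Pr a u) = Pr a (D i u) + ∑ j, ∑ l, D i (a j l) * D l (D j u) := by
  simp only [Pr, map_sum, D_mul, ← Finset.sum_add_distrib]
  refine Finset.sum_congr rfl fun j _ => Finset.sum_congr rfl fun l _ => ?_
  rw [D_comm i l, D_comm i j, mul_comm (D l _)]

lemma garding (a : Fin d → Fin d → SP d) {amin : ℝ}
    (hell : ∀ (x ξ : Fin d → ℝ), amin * ∑ i, ξ i ^ 2 ≤ ∑ j, ∑ k, a j k x * (ξ j * ξ k))
    (k : ℕ) {c : ℝ} (hc : c < amin) :
    ∃ C, 0 ≤ C ∧ ∀ u, ip k (Pr a u) u ≤ -c * ∑ j, N k (D j u) + C * N k u := by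
  induction k generalizing c with
  | zero => exact garding_base a hc hell
  | succ k ih =>
    obtain ⟨C0, hC0, h0⟩ := garding_base a hc hell
    obtain ⟨c', hc1, hc2⟩ := exists_between hc
    obtain ⟨C1, hC1, h1⟩ := ih hc2
    have hε : 0 < (c' - c) / (d + 1) := div_pos (sub_pos.2 hc1) (by positivity)
    choose C hC h using fun i j l => ip_lo k (D i (a j l)) hε
    have hS : 0 ≤ ∑ i, ∑ j, ∑ l, C i j l := Finset.sum_nonneg fun i _ =>
      Finset.sum_nonneg fun j _ => Finset.sum_nonneg fun l _ => hC i j l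
    refine ⟨C0 + C1 + ∑ i, ∑ j, ∑ l, C i j l, by positivity, fun u => ?_⟩
    set T := ∑ j, ∑ l, N k (D l (D j u)) with hT
    have hT0 : 0 ≤ T := Finset.sum_nonneg fun j _ => Finset.sum_nonneg fun l _ => N_nonneg _ _
    rw [ip_succ]
    have e1 : ∑ i, ip k (D i (Pr a u)) (D i u) = ∑ i, ip k (Pr a (D i u)) (D i u)
        + ∑ i, ∑ j, ∑ l, ip k (D i (a j l) * D l (D j u)) (D i u) := by
      rw [← Finset.sum_add_distrib]
      refine Finset.sum_congr rfl fun i _ => ?_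
      rw [D_Pr]
      simp [LinearMap.sum_apply]
    have e2 : ∑ i, ip k (Pr a (D i u)) (D i u) ≤ -c' * T + C1 * ∑ i, N k (D i u) := by
      rw [hT, Finset.mul_sum, Finset.mul_sum, ← Finset.sum_add_distrib]
      exact Finset.sum_le_sum fun i _ => h1 _
    have e3 : ∑ i, ∑ j, ∑ l, ip k (D i (a j l) * D l (D j u)) (D i u)
        ≤ ∑ i, ∑ j, ∑ l, ((c' - c) / (d + 1) * N k (D l (D j u)) + C i j l * N (k+1) u) := by
      refine Finset.sum_le_sum fun i _ => Finset.sum_le_sum fun j _ =>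
        Finset.sum_le_sum fun l _ => (h i j l _ _).trans ?_
      gcongr
      · exact hC i j l
      · exact N_D k i u
    have e4 : ∑ i : Fin d, ∑ j, ∑ l, ((c' - c) / (d + 1) * N k (D l (D j u))
        + C i j l * N (k+1) u)
        = (d * ((c' - c) / (d + 1))) * T + (∑ i, ∑ j, ∑ l, C i j l) * N (k+1) u := by
      simp only [Finset.sum_add_distrib, Finset.sum_const, Finset.card_univ, Fintype.card_fin,
        nsmul_eq_mul, Finset.sum_mul, Finset.mul_sum, mul_assoc, hT]
    have e5 : (d * ((c' - c) / (d + 1))) ≤ c' - c := by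
      rw [mul_div_assoc', div_le_iff₀ (by positivity)]
      nlinarith
    have e6 := mul_le_mul_of_nonneg_right e5 hT0
    have e7 : ∑ j, N (k+1) (D j u) = ∑ j, N 0 (D j u) + T := by
      simp only [N_succ, Finset.sum_add_distrib, hT]
    have e8 : C0 * N 0 u ≤ C0 * N (k+1) u :=
      mul_le_mul_of_nonneg_left (N_mono (Nat.zero_le _) u) hC0
    have e9 : C1 * ∑ i, N k (D i u) ≤ C1 * N (k+1) u := by
      rw [N_succ]; exact mul_le_mul_of_nonneg_left (le_add_of_nonneg_left (N_nonneg _ _)) hC1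
    have e0 := h0 u
    rw [e1, e7]
    linarith

/-! Systems. -/
variable {m : ℕ}

/-- Sobolev inner product for systems. -/
def ipS (k : ℕ) (u v : Fin m → SP d) : ℝ := ∑ α, ip k (u α) (v α)
/-- Sobolev norm for systems. -/
def NS (k : ℕ) (u : Fin m → SP d) : ℝ := ∑ α, N k (u α)

/-- The modified generator `L u - mean u`. -/
def Lop (b : Fin m → Fin d → SP d) (a : Fin m → Fin d → Fin d → SP d)
    (q : Fin m → Fin m → SP d) : (Fin m → SP d) →ₗ[ℝ] (Fin m → SP d) where
  toFun u α := ∑ j, b α j * D j (u α) + (1/2 : ℝ) • Pr (a α) (u α) + ∑ β, q α β * u β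
    - (∑ β, I (u β)) • (1 : SP d)
  map_add' u v := by
    ext1 α
    simp only [Pr, Pi.add_apply, map_add, mul_add, Finset.sum_add_distrib, smul_add, add_smul]
    abel
  map_smul' c u := by
    ext1 α
    simp only [Pr, Pi.smul_apply, map_smul, mul_smul_comm, ← Finset.smul_sum, smul_eq_mul,
      ← Finset.mul_sum, RingHom.id_apply, smul_sub, smul_add, mul_smul]
    rw [smul_comm (1/2:ℝ) c]

lemma NS_nonneg (k : ℕ) (u : Fin m → SP d) : 0 ≤ NS k u :=
  Finset.sum_nonneg fun _ _ => N_nonneg _ _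

lemma gardingS (b : Fin m → Fin d → SP d) (a : Fin m → Fin d → Fin d → SP d)
    (q : Fin m → Fin m → SP d) {amin : ℝ} (ham : 0 < amin)
    (hell : ∀ α (x ξ : Fin d → ℝ), amin * ∑ i, ξ i ^ 2 ≤ ∑ j, ∑ k, a α j k x * (ξ j * ξ k))
    (k : ℕ) : ∃ c C, 0 < c ∧ 0 ≤ C ∧ ∀ u : Fin m → SP d,
      c * NS (k+1) u ≤ C * NS 0 u - ipS k (Lop b a q u) u := by
  -- constants
  choose C1 hC1 h1 using fun α => garding (a α) (hell α) k (half_lt_self ham)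
  have h8 : 0 < amin / 8 := by positivity
  choose C2 hC2 h2 using fun α j => ip_lo k (b α j) h8
  choose C3 hC3 h3 using fun α β => ip_lo k (q α β) one_pos
  -- total zeroth-order constant
  set CT := ∑ α, (C1 α + ∑ j, C2 α j + ∑ β, C3 α β) + m with hCT
  have hCT0 : 0 ≤ CT := by
    have : 0 ≤ ∑ α, (C1 α + ∑ j, C2 α j + ∑ β, C3 α β) := Finset.sum_nonneg fun α _ =>
      add_nonneg (add_nonneg (hC1 α) (Finset.sum_nonneg fun j _ => hC2 α j))
        (Finset.sum_nonneg fun β _ => hC3 α β)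
    positivity
  have hε : 0 < (amin/16) / (CT + 1) := by positivity
  obtain ⟨C4, hC4, h4⟩ := interp (d := d) k hε
  refine ⟨amin/16, CT * C4 + amin/16, by positivity, by positivity, fun u => ?_⟩
  set G := ∑ α, ∑ j, N k (D j (u α)) with hG
  have hG0 : 0 ≤ G := Finset.sum_nonneg fun j _ => Finset.sum_nonneg fun l _ => N_nonneg _ _
  have hNS : NS (k+1) u = NS 0 u + G := by
    simp only [NS, N_succ, Finset.sum_add_distrib, hG]
  -- termwise
  have e1 : ∀ α, ip k (Lop b a q u α) (u α) = ∑ j, ip k (b α j * D j (u α)) (u α)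
      + 1/2 * ip k (Pr (a α) (u α)) (u α) + ∑ β, ip k (q α β * u β) (u α)
      - (∑ β, I (u β)) * I (u α) := by
    intro α
    simp [Lop, LinearMap.sum_apply, ip_one]
  have e2 : ∀ α, ip k (Lop b a q u α) (u α) ≤ (amin/8) * ∑ j, N k (D j (u α))
      + (∑ j, C2 α j) * N k (u α)
      + 1/2 * (-(amin/2) * ∑ j, N k (D j (u α)) + C1 α * N k (u α))
      + (∑ β, N k (u β) + (∑ β, C3 α β) * N k (u α))
      - (∑ β, I (u β)) * I (u α) := by
    intro α
    rw [e1]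
    have f1 : ∑ j, ip k (b α j * D j (u α)) (u α) ≤ (amin/8) * ∑ j, N k (D j (u α))
        + (∑ j, C2 α j) * N k (u α) := by
      rw [Finset.mul_sum, Finset.sum_mul, ← Finset.sum_add_distrib]
      exact Finset.sum_le_sum fun j _ => h2 α j _ _
    have f2 : ∑ β, ip k (q α β * u β) (u α) ≤ ∑ β, N k (u β) + (∑ β, C3 α β) * N k (u α) := by
      rw [Finset.sum_mul, ← Finset.sum_add_distrib]
      exact Finset.sum_le_sum fun β _ => (h3 α β _ _).trans (by rw [one_mul])
    have f3 := h1 α (u α)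
    linarith
  have e3 : ipS k (Lop b a q u) u ≤ -(amin/8) * G + CT * NS k u := by
    have g1 : ipS k (Lop b a q u) u ≤ ∑ α, (-(amin/8) * ∑ j, N k (D j (u α))
        + (C1 α + ∑ j, C2 α j + ∑ β, C3 α β) * N k (u α) + NS k u
        - (∑ β, I (u β)) * I (u α)) := by
      refine Finset.sum_le_sum fun α _ => (e2 α).trans ?_
      have := mul_nonneg (hC1 α) (N_nonneg k (u α))
      unfold NS
      nlinarith
    have g2 : ∑ α, (C1 α + ∑ j, C2 α j + ∑ β, C3 α β) * N k (u α)
        ≤ (∑ α, (C1 α + ∑ j, C2 α j + ∑ β, C3 α β)) * NS k u := by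
      rw [Finset.sum_mul]
      refine Finset.sum_le_sum fun α _ => mul_le_mul_of_nonneg_left ?_ ?_
      · exact Finset.single_le_sum (f := fun α => N k (u α)) (fun α _ => N_nonneg _ _)
          (Finset.mem_univ α)
      · exact add_nonneg (add_nonneg (hC1 α) (Finset.sum_nonneg fun j _ => hC2 α j))
          (Finset.sum_nonneg fun β _ => hC3 α β)
    simp only [Finset.sum_sub_distrib, Finset.sum_add_distrib, ← Finset.mul_sum,
      Finset.sum_const, Finset.card_univ, Fintype.card_fin, nsmul_eq_mul] at g1
    simp only [Finset.sum_add_distrib] at g2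
    have g3 := mul_self_nonneg (∑ β, I (u β))
    rw [hCT, add_mul, hG]
    simp only [Finset.sum_add_distrib]
    linarith
  have e4 : NS k u ≤ (amin/16) / (CT + 1) * G + C4 * NS 0 u := by
    unfold NS
    rw [hG, Finset.mul_sum, Finset.mul_sum, ← Finset.sum_add_distrib]
    exact Finset.sum_le_sum fun α _ => h4 _
  have e5 := mul_le_mul_of_nonneg_left e4 hCT0
  have e6 : CT * ((amin/16) / (CT + 1) * G) ≤ amin/16 * G := by
    rw [← mul_assoc]
    refine mul_le_mul_of_nonneg_right ?_ hG0
    rw [mul_div_assoc', div_le_iff₀ (by positivity)]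
    nlinarith
  rw [hNS]
  nlinarith
end SP

end Part3

section Part4
open MeasureTheory Matrix Finset
lemma sob1 {g g' : ℝ → ℝ} (hg : ∀ t, HasDerivAt g (g' t) t) (hg' : Continuous g')
    {t : ℝ} (ht : t ∈ Set.Icc (0:ℝ) 1) :
    g t ^ 2 ≤ 2 * ∫ s in (0:ℝ)..1, (g s ^ 2 + g' s ^ 2) := by
  have hgc : Continuous g := continuous_iff_continuousAt.2 fun t => (hg t).continuousAt
  have hF : Continuous fun s => g s ^ 2 + g' s ^ 2 := by fun_prop
  set A := ∫ s in (0:ℝ)..1, (g s ^ 2 + g' s ^ 2) with hA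
  have key : ∀ s ∈ Set.Icc (0:ℝ) 1, g t ^ 2 ≤ g s ^ 2 + A := by
    intro s hs
    have h1 : ∫ r in s..t, 2 * g r * g' r = g t ^ 2 - g s ^ 2 := by
      apply intervalIntegral.integral_eq_sub_of_hasDerivAt (f := fun r => g r ^ 2)
      · intro r _
        have := (hg r).fun_pow 2
        simpa using this
      · exact (by fun_prop : Continuous fun r => 2 * g r * g' r).intervalIntegrable _ _
    have h2 : |∫ r in s..t, 2 * g r * g' r| ≤ |∫ r in s..t, (g r ^ 2 + g' r ^ 2)| := by
      rw [← Real.norm_eq_abs]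
      apply intervalIntegral.norm_integral_le_abs_of_norm_le
      · refine Filter.Eventually.of_forall fun r => ?_
        rw [Real.norm_eq_abs, abs_le]
        constructor <;> nlinarith [sq_nonneg (g r + g' r), sq_nonneg (g r - g' r)]
      · exact hF.intervalIntegrable _ _
    have h3 : |∫ r in s..t, (g r ^ 2 + g' r ^ 2)| ≤ A := by
      have : |∫ r in s..t, (g r ^ 2 + g' r ^ 2)| ≤ |∫ r in (0:ℝ)..1, (g r ^ 2 + g' r ^ 2)| := by
        apply intervalIntegral.abs_integral_mono_interval
        · rw [Set.uIoc_of_le zero_le_one]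
          intro r hr
          rw [Set.mem_uIoc] at hr
          rcases hr with hr | hr
          · exact ⟨hs.1.trans_lt hr.1, hr.2.trans ht.2⟩
          · exact ⟨ht.1.trans_lt hr.1, hr.2.trans hs.2⟩
        · exact Filter.Eventually.of_forall fun r => by positivity
        · exact hF.intervalIntegrable _ _
      refine this.trans (le_of_eq (abs_of_nonneg ?_))
      exact intervalIntegral.integral_nonneg zero_le_one fun r _ => by positivity
    have := (le_abs_self _).trans (h2.trans h3)
    rw [h1] at this
    linarith
  have h5 : ∫ s in (0:ℝ)..1, g t ^ 2 ≤ ∫ s in (0:ℝ)..1, (g s ^ 2 + A) :=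
    intervalIntegral.integral_mono_on zero_le_one
      (continuous_const.intervalIntegrable _ _)
      ((by fun_prop : Continuous fun s => g s ^ 2 + A).intervalIntegrable _ _) key
  have h6 : ∫ s in (0:ℝ)..1, g s ^ 2 ≤ A :=
    intervalIntegral.integral_mono_on zero_le_one
      ((by fun_prop : Continuous fun s => g s ^ 2).intervalIntegrable _ _)
      (hF.intervalIntegrable _ _) fun s _ => by nlinarith [sq_nonneg (g' s)]
  rw [intervalIntegral.integral_add
    ((by fun_prop : Continuous fun s => g s ^ 2).intervalIntegrable _ _)
    (continuous_const.intervalIntegrable _ _)] at h5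
  simp at h5
  linarith

namespace SP
variable {d : ℕ}

/-- Sobolev energy density. -/
def E : ℕ → SP d → SP d
  | 0, u => u * u
  | k+1, u => u * u + ∑ j, E k (D j u)

lemma I_E (k : ℕ) (u : SP d) : I (E k u) = N k u := by
  induction k generalizing u with
  | zero => rfl
  | succ k ih => rw [N_succ, E]; simp [ih, N_zero]

lemma E_nonneg (k : ℕ) (u : SP d) (x) : 0 ≤ E k u x := by
  induction k generalizing u with
  | zero => exact mul_self_nonneg _
  | succ k ih =>
    rw [E, add_app, sum_app]
    exact add_nonneg (mul_self_nonneg _) (Finset.sum_nonneg fun j _ => ih _)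

lemma E_mono (k : ℕ) (u : SP d) (x) : E k u x ≤ E (k+1) u x := by
  induction k generalizing u with
  | zero =>
    rw [E, E, add_app, sum_app]
    exact le_add_of_nonneg_right (Finset.sum_nonneg fun j _ => E_nonneg _ _ _)
  | succ k ih =>
    rw [E, E, add_app, sum_app, add_app, sum_app]
    gcongr with j
    exact ih _

lemma E_D (k : ℕ) (j : Fin d) (u : SP d) (x) : E k (D j u) x ≤ E (k+1) u x := by
  rw [E, add_app, sum_app]
  have := Finset.single_le_sum (f := fun j => E k (D j u) x) (fun j _ => E_nonneg _ _ _)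
    (Finset.mem_univ j)
  have h0 : 0 ≤ (u * u) x := mul_self_nonneg _
  linarith

lemma sob_line (u : SP d) (i : Fin d) (x : Fin d → ℝ) :
    ENNReal.ofReal (u x ^ 2) ≤ 2 * ∫⁻ t in Set.Ico (0:ℝ) 1,
      (ENNReal.ofReal (u (Function.update x i t) ^ 2)
        + ENNReal.ofReal (D i u (Function.update x i t) ^ 2)) := by
  have hupd : ∀ t, HasDerivAt (fun t => Function.update x i t) (Pi.single i (1:ℝ)) t := by
    intro t
    have := hasDerivAt_update x i t
    exact this
  have hc : Continuous fun t => Function.update x i t :=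
    continuous_iff_continuousAt.2 fun t => (hupd t).continuousAt
  have hg : ∀ t, HasDerivAt (fun t => u (Function.update x i t))
      (D i u (Function.update x i t)) t := by
    intro t
    exact ((diff u _).hasFDerivAt).comp_hasDerivAt t (hupd t)
  have hg' : Continuous fun t => D i u (Function.update x i t) := (cont (D i u)).comp hc
  have h1 := sob1 hg hg' (t := Int.fract (x i)) ⟨Int.fract_nonneg _, (Int.fract_lt_one _).le⟩
  have h2 : u (Function.update x i (Int.fract (x i))) = u x := by
    rw [← per u (Function.update x i (Int.fract (x i))) (Pi.single i ⌊x i⌋)]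
    refine congrArg u.1 (funext fun l => ?_)
    by_cases hl : l = i
    · subst hl; simp [Int.fract_add_floor]
    · simp [hl]
  simp only [h2] at h1
  have hF : Continuous fun t => u (Function.update x i t) ^ 2 + D i u (Function.update x i t) ^ 2 :=
    (((cont u).comp hc).pow 2).add (hg'.pow 2)
  refine (ENNReal.ofReal_le_ofReal h1).trans ?_
  rw [ENNReal.ofReal_mul zero_le_two, intervalIntegral.integral_of_le zero_le_one,
    ← integral_Ico_eq_integral_Ioc,
    ofReal_integral_eq_lintegral_ofReal
      ((hF.continuousOn.integrableOn_compact isCompact_Icc).mono_set Set.Ico_subset_Icc_self)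
      (Filter.Eventually.of_forall fun t => by positivity)]
  simp only [ENNReal.ofReal_ofNat]
  gcongr with t
  rw [ENNReal.ofReal_add (sq_nonneg _) (sq_nonneg _)]

/-- the one-dimensional measures -/
def mu1 (d : ℕ) : Fin d → Measure ℝ := fun _ => volume.restrict (Set.Ico (0:ℝ) 1)

instance (i : Fin d) : SigmaFinite (mu1 d i) := by unfold mu1; infer_instance

lemma sob_marg (s : Finset (Fin d)) (u : SP d) (x : Fin d → ℝ) :
    ENNReal.ofReal (u x ^ 2) ≤ 4 ^ s.card *
      lmarginal (mu1 d) s (fun y => ENNReal.ofReal (E s.card u y)) x := by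
  induction s using Finset.induction_on generalizing u x with
  | empty => simp [E, sq]
  | insert i s hi ih =>
    have hm : Measurable (fun y => ENNReal.ofReal (E (insert i s).card u y)) :=
      (cont (E _ u)).measurable.ennreal_ofReal
    rw [lmarginal_insert _ hm hi, Finset.card_insert_of_notMem hi]
    refine (sob_line u i x).trans ?_
    have h : ∀ y, ENNReal.ofReal (u y ^ 2) + ENNReal.ofReal (D i u y ^ 2)
        ≤ 2 * 4 ^ s.card * lmarginal (mu1 d) s
          (fun y => ENNReal.ofReal (E (s.card + 1) u y)) y := by
      intro y
      have a1 := (ih u y).trans (mul_le_mul_right (lmarginal_mono (μ := mu1 d)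
        (g := fun y => ENNReal.ofReal (E (s.card + 1) u y))
        (fun z => ENNReal.ofReal_le_ofReal (E_mono _ u z)) y) _)
      have a2 := (ih (D i u) y).trans (mul_le_mul_right (lmarginal_mono (μ := mu1 d)
        (g := fun y => ENNReal.ofReal (E (s.card + 1) u y))
        (fun z => ENNReal.ofReal_le_ofReal (E_D _ i u z)) y) _)
      refine (add_le_add a1 a2).trans (le_of_eq ?_)
      ring
    have hm2 : Measurable (fun y => ENNReal.ofReal (E (s.card + 1) u y)) :=
      (cont (E _ u)).measurable.ennreal_ofReal
    calc _ ≤ 2 * ∫⁻ t in Set.Ico (0:ℝ) 1, 2 * 4 ^ s.card * lmarginal (mu1 d) s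
          (fun y => ENNReal.ofReal (E (s.card + 1) u y)) (Function.update x i t) := by
            gcongr with t
            exact h _
      _ = _ := by
        rw [lintegral_const_mul' _ _ (by finiteness)]
        rw [pow_succ, ← mul_assoc]
        congr 1
        rw [show (4 : ENNReal) = 2 * 2 by norm_num]; ring

lemma sob (u : SP d) (x : Fin d → ℝ) : u x ^ 2 ≤ 4 ^ d * N d u := by
  have h := sob_marg Finset.univ u x
  rw [lmarginal_univ, Finset.card_univ, Fintype.card_fin] at h
  have hpi : Measure.pi (mu1 d) = (volume : Measure (Fin d → ℝ)).restrict (cube d) := by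
    rw [volume_pi, cube, Measure.restrict_pi_pi]; rfl
  rw [hpi, ← ofReal_integral_eq_lintegral_ofReal (cube_integrable (cont (E d u)))
    (Filter.Eventually.of_forall fun y => E_nonneg _ _ _), ← tInt_def, ← I_def, I_E] at h
  rw [show (4 : ENNReal) ^ d = ENNReal.ofReal (4 ^ d) by
    rw [ENNReal.ofReal_pow (by norm_num)]; norm_num,
    ← ENNReal.ofReal_mul (by positivity)] at h
  rwa [ENNReal.ofReal_le_ofReal_iff (mul_nonneg (by positivity) (N_nonneg _ _))] at h
end SP

end Part4

section Part5
open MeasureTheory Matrix Finset Filter Topology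
lemma clm_sum_single {d : ℕ} (L : (Fin d → ℝ) →L[ℝ] ℝ) :
    L = ∑ i, L (Pi.single i 1) • (ContinuousLinearMap.proj i : (Fin d → ℝ) →L[ℝ] ℝ) := by
  ext x
  simp only [_root_.sum_apply, _root_.smul_apply,
    ContinuousLinearMap.proj_apply, smul_eq_mul]
  conv_lhs => rw [pi_eq_sum_univ' x]
  simp only [map_sum, map_smul, smul_eq_mul]
  refine Finset.sum_congr rfl fun i _ => ?_
  rw [mul_comm]

lemma tu_sum {ι X F : Type*} [NormedAddCommGroup F] (s : Finset ι) (f : ι → ℕ → X → F)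
    (g : ι → X → F) (h : ∀ i ∈ s, TendstoUniformly (f i) (g i) atTop) :
    TendstoUniformly (fun n x => ∑ i ∈ s, f i n x) (fun x => ∑ i ∈ s, g i x) atTop := by
  classical
  induction s using Finset.induction_on with
  | empty =>
    simp only [Finset.sum_empty]
    rw [Metric.tendstoUniformly_iff]
    intro ε hε
    simp [hε]
  | insert i s hi ih =>
    simp only [Finset.sum_insert hi]
    exact (h i (Finset.mem_insert_self _ _)).fun_add
      (ih fun j hj => h j (Finset.mem_insert_of_mem hj))

lemma c1_limit {d : ℕ} (f : ℕ → SP d) (g : (Fin d → ℝ) → ℝ) (g1 : Fin d → (Fin d → ℝ) → ℝ)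
    (h0 : ∀ x, Tendsto (fun n => f n x) atTop (𝓝 (g x)))
    (h1 : ∀ i, TendstoUniformly (fun n => (SP.D i (f n)).1) (g1 i) atTop) (x) :
    HasFDerivAt g (∑ i, g1 i x • (ContinuousLinearMap.proj i : (Fin d → ℝ) →L[ℝ] ℝ)) x := by
  refine hasFDerivAt_of_tendstoUniformly (l := atTop) (f := fun n => (f n).1)
    (f' := fun n x => ∑ i, SP.D i (f n) x • (ContinuousLinearMap.proj i : (Fin d → ℝ) →L[ℝ] ℝ))
    (g' := fun x => ∑ i, g1 i x • (ContinuousLinearMap.proj i : (Fin d → ℝ) →L[ℝ] ℝ))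
    ?_ ?_ h0 x
  · apply tu_sum
    intro i _
    exact ((ContinuousLinearMap.smulRight (1 : ℝ →L[ℝ] ℝ)
      (ContinuousLinearMap.proj i : (Fin d → ℝ) →L[ℝ] ℝ)).uniformContinuous.comp_tendstoUniformly
        (h1 i))
  · intro n x
    have := (SP.diff (f n) x).hasFDerivAt
    rw [clm_sum_single (fderiv ℝ (f n).1 x)] at this
    exact this

lemma pd_of_hasFDerivAt {d : ℕ} {g : (Fin d → ℝ) → ℝ} {c : Fin d → ℝ} {x}
    (h : HasFDerivAt g (∑ i, c i • (ContinuousLinearMap.proj i : (Fin d → ℝ) →L[ℝ] ℝ)) x)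
    (j : Fin d) : pd g j x = c j := by
  unfold pd
  rw [h.fderiv]
  simp [Pi.single_apply]

lemma c2_limit {d : ℕ} (f : ℕ → SP d) (g : (Fin d → ℝ) → ℝ) (g1 : Fin d → (Fin d → ℝ) → ℝ)
    (g2 : Fin d → Fin d → (Fin d → ℝ) → ℝ)
    (h0 : TendstoUniformly (fun n => (f n).1) g atTop)
    (h1 : ∀ i, TendstoUniformly (fun n => (SP.D i (f n)).1) (g1 i) atTop)
    (h2 : ∀ i j, TendstoUniformly (fun n => (SP.D j (SP.D i (f n))).1) (g2 i j) atTop) :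
    ContDiff ℝ 2 g ∧ Per g ∧ (∀ i, pd g i = g1 i) ∧ (∀ i j, pd2 g i j = g2 i j) := by
  have H0 := c1_limit f g g1 (fun x => h0.tendsto_at x) h1
  have H1 := fun i => c1_limit (fun n => SP.D i (f n)) (g1 i) (g2 i)
    (fun x => (h1 i).tendsto_at x) (h2 i)
  have hg2 : ∀ i j, Continuous (g2 i j) := fun i j =>
    (h2 i j).continuous (Frequently.of_forall fun n => SP.cont _)
  have hp1 : ∀ i, pd g i = g1 i := fun i => funext fun x => pd_of_hasFDerivAt (H0 x) i
  have hp2 : ∀ i j, pd (g1 i) j = g2 i j :=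
    fun i j => funext fun x => pd_of_hasFDerivAt (H1 i x) j
  have hc1 : ∀ i, ContDiff ℝ 1 (g1 i) := by
    intro i
    rw [contDiff_one_iff_fderiv]
    refine ⟨fun x => (H1 i x).differentiableAt, ?_⟩
    have : fderiv ℝ (g1 i) = fun x => ∑ j, g2 i j x •
        (ContinuousLinearMap.proj j : (Fin d → ℝ) →L[ℝ] ℝ) := funext fun x => (H1 i x).fderiv
    rw [this]
    exact continuous_finsetSum _ fun j _ => (hg2 i j).smul continuous_const
  refine ⟨?_, ?_, hp1, ?_⟩
  · rw [show (2 : WithTop ℕ∞) = 1 + 1 by norm_num, contDiff_succ_iff_fderiv]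
    refine ⟨fun x => (H0 x).differentiableAt, by simp, ?_⟩
    have : fderiv ℝ g = fun x => ∑ j, g1 j x •
        (ContinuousLinearMap.proj j : (Fin d → ℝ) →L[ℝ] ℝ) := funext fun x => (H0 x).fderiv
    rw [this]
    exact ContDiff.sum fun j _ => (hc1 j).smul contDiff_const
  · intro x ν
    refine tendsto_nhds_unique (h0.tendsto_at _) ?_
    have := h0.tendsto_at x
    refine this.congr fun n => ?_
    exact (SP.per (f n) x ν).symm
  · intro i j
    unfold pd2
    rw [show (fun y => pd g i y) = g1 i from hp1 i]
    exact hp2 i j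

lemma arzela {d : ℕ} {J : Type*} [Fintype J] (g : ℕ → J → SP d) (C : ℝ)
    (hb : ∀ n j x, |g n j x| ≤ C) (hD : ∀ n j i x, |SP.D i (g n j) x| ≤ C) :
    ∃ θ : ℕ → ℕ, StrictMono θ ∧ ∃ G : J → (Fin d → ℝ) → ℝ,
      ∀ j, TendstoUniformly (fun n => (g (θ n) j).1) (G j) atTop := by
  let X := Set.Icc (0 : Fin d → ℝ) 1
  have : CompactSpace X := isCompact_iff_compactSpace.1 isCompact_Icc
  have hC : 0 ≤ d * |C| := by positivity
  have hlip : ∀ n j, LipschitzWith (Real.toNNReal (d * |C|)) (g n j).1 := by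
    intro n j
    apply lipschitzWith_of_nnnorm_fderiv_le (𝕜 := ℝ) (SP.diff _)
    intro x
    rw [← NNReal.coe_le_coe, Real.coe_toNNReal _ hC, coe_nnnorm,
      clm_sum_single (fderiv ℝ (g n j).1 x)]
    refine (norm_sum_le _ _).trans ?_
    have : ∀ i ∈ (Finset.univ : Finset (Fin d)), ‖fderiv ℝ (g n j).1 x (Pi.single i 1) •
      (ContinuousLinearMap.proj i : (Fin d → ℝ) →L[ℝ] ℝ)‖ ≤ |C| := by
      intro i _
      rw [norm_smul]
      have h1 : ‖(ContinuousLinearMap.proj i : (Fin d → ℝ) →L[ℝ] ℝ)‖ ≤ 1 :=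
        ContinuousLinearMap.opNorm_le_bound _ zero_le_one fun v => by
          rw [one_mul]; exact norm_le_pi_norm v i
      have h2 : ‖fderiv ℝ (g n j).1 x (Pi.single i 1)‖ ≤ |C| :=
        (hD n j i x).trans (le_abs_self C)
      calc _ ≤ |C| * 1 := mul_le_mul h2 h1 (norm_nonneg _) (abs_nonneg _)
        _ = |C| := mul_one _
    refine (Finset.sum_le_sum this).trans ?_
    simp
  let F : ℕ → BoundedContinuousFunction X (J → ℝ) := fun n =>
    BoundedContinuousFunction.mkOfCompact
      ⟨fun x j => g n j x.1, continuous_pi fun j => (SP.cont _).comp continuous_subtype_val⟩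
  have hFapp : ∀ n x j, F n x j = g n j x.1 := fun n x j => rfl
  have hcomp : IsCompact (closure (Set.range F)) := by
    refine BoundedContinuousFunction.arzela_ascoli (Metric.closedBall 0 |C|)
      (isCompact_closedBall _ _) _ ?_ ?_
    · rintro _ x ⟨n, rfl⟩
      rw [mem_closedBall_zero_iff, pi_norm_le_iff_of_nonneg (abs_nonneg _)]
      exact fun j => (hb n j x.1).trans (le_abs_self C)
    · refine (LipschitzWith.uniformEquicontinuous _ (Real.toNNReal (d * |C|)) ?_).equicontinuous
      rintro ⟨_, n, rfl⟩
      refine LipschitzWith.of_dist_le_mul fun x y => ?_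
      refine (dist_pi_le_iff (by positivity)).2 fun j => ?_
      exact (hlip n j).dist_le_mul x.1 y.1
  obtain ⟨G, -, θ, hθ, hG⟩ := hcomp.tendsto_subseq (x := F) fun n => subset_closure ⟨n, rfl⟩
  refine ⟨θ, hθ, fun j x => G ⟨fun i => Int.fract (x i), cube_sub d (fract_mem_cube x)⟩ j,
    fun j => ?_⟩
  rw [Metric.tendstoUniformly_iff]
  intro ε hε
  filter_upwards [Metric.tendsto_nhds.1 hG ε hε] with n hn x
  rw [← per_fract (SP.per (g (θ n) j)) x, dist_comm]
  have h1 := (BoundedContinuousFunction.dist_coe_le_dist (f := F (θ n)) (g := G)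
    ⟨fun i => Int.fract (x i), cube_sub d (fract_mem_cube x)⟩).trans_lt hn
  exact (dist_le_pi_dist _ _ j).trans_lt h1

end Part5

section Part6
open MeasureTheory Matrix Finset Filter Topology
lemma fderiv_eq_pd {d : ℕ} (f : (Fin d → ℝ) → ℝ) (x ξ : Fin d → ℝ) :
    fderiv ℝ f x ξ = ∑ j, ξ j * pd f j x := by
  conv_lhs => rw [clm_sum_single (fderiv ℝ f x)]
  simp only [_root_.sum_apply, _root_.smul_apply, ContinuousLinearMap.proj_apply, smul_eq_mul]
  exact Finset.sum_congr rfl fun j _ => mul_comm _ _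

lemma hasDerivAt_line {d : ℕ} {f : (Fin d → ℝ) → ℝ} (hf : Differentiable ℝ f)
    (p ξ : Fin d → ℝ) (t : ℝ) :
    HasDerivAt (fun t : ℝ => f (p + t • ξ)) (∑ j, ξ j * pd f j (p + t • ξ)) t := by
  rw [← fderiv_eq_pd]
  have h1 : HasDerivAt (fun t : ℝ => p + t • ξ) ξ t := by
    have := ((hasDerivAt_id t).smul_const ξ).const_add p
    simpa using this
  exact (hf _).hasFDerivAt.comp_hasDerivAt t h1

lemma pd_localMin {d : ℕ} {w : (Fin d → ℝ) → ℝ} {p} (h : IsLocalMin w p) (j : Fin d) :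
    pd w j p = 0 := by
  unfold pd; rw [h.fderiv_eq_zero]; simp

lemma hess_localMin {d : ℕ} {w : (Fin d → ℝ) → ℝ} {p} (hw : ContDiff ℝ 2 w) (h : IsLocalMin w p)
    (ξ : Fin d → ℝ) : 0 ≤ ∑ j, ∑ k, ξ j * ξ k * pd2 w j k p := by
  have hd : Differentiable ℝ w := hw.differentiable (by norm_num)
  have hd1 : ∀ j, Differentiable ℝ (pd w j) := fun j =>
    (pd_contDiff hw (k := 1) (by norm_num) j).differentiable (by norm_num)
  set g : ℝ → ℝ := fun t => w (p + t • ξ) with hg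
  have e1 : deriv g = fun t => ∑ j, ξ j * pd w j (p + t • ξ) :=
    funext fun t => (hasDerivAt_line hd p ξ t).deriv
  have e2 : deriv (deriv g) 0 = ∑ j, ∑ k, ξ j * ξ k * pd2 w j k p := by
    rw [e1]
    have : HasDerivAt (fun t : ℝ => ∑ j, ξ j * pd w j (p + t • ξ))
        (∑ j, ξ j * ∑ k, ξ k * pd (pd w j) k (p + (0:ℝ) • ξ)) 0 :=
      HasDerivAt.fun_sum fun j _ => (hasDerivAt_line (hd1 j) p ξ 0).const_mul (ξ j)
    rw [this.deriv]
    refine Finset.sum_congr rfl fun j _ => ?_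
    rw [Finset.mul_sum]
    refine Finset.sum_congr rfl fun k _ => ?_
    simp only [zero_smul, add_zero, pd2]
    ring
  have hc : Continuous fun t : ℝ => p + t • ξ := by fun_prop
  have hmin : IsLocalMin g 0 := by
    have h' : ∀ᶠ x in 𝓝 (p + (0:ℝ) • ξ), w p ≤ w x := by
      rw [zero_smul, add_zero]; exact h
    have := hc.continuousAt.eventually h'
    simpa [IsLocalMin, IsMinFilter, hg] using this
  by_contra hneg
  rw [← e2, not_le] at hneg
  have hmax : IsLocalMax g 0 := by
    refine isLocalMax_of_deriv_deriv_neg hneg hmin.deriv_eq_zero ?_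
    exact (hasDerivAt_line hd p ξ 0).continuousAt
  have heq : g =ᶠ[𝓝 0] fun _ => g 0 := by
    filter_upwards [hmin, hmax] with t h1 h2
    exact le_antisymm h2 h1
  have h3 := heq.deriv.deriv_eq
  rw [h3] at hneg
  simp at hneg

/-- scalar elliptic operator -/
def Sop {d r : ℕ} (b : (Fin d → ℝ) → Fin d → ℝ) (σ : (Fin d → ℝ) → Matrix (Fin d) (Fin r) ℝ)
    (u : (Fin d → ℝ) → ℝ) (x : Fin d → ℝ) : ℝ :=
  (∑ j, b x j * pd u j x) + (1/2) * ∑ j, ∑ k, (σ x * (σ x)ᵀ) j k * pd2 u j k x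

lemma Sop_localMin {d r : ℕ} (b : (Fin d → ℝ) → Fin d → ℝ)
    (σ : (Fin d → ℝ) → Matrix (Fin d) (Fin r) ℝ) {w : (Fin d → ℝ) → ℝ} {p}
    (hw : ContDiff ℝ 2 w) (h : IsLocalMin w p) : 0 ≤ Sop b σ w p := by
  unfold Sop
  have h1 : ∑ j, ∑ k, (σ p * (σ p)ᵀ) j k * pd2 w j k p
      = ∑ l, ∑ j, ∑ k, σ p j l * σ p k l * pd2 w j k p := by
    rw [Finset.sum_comm]
    simp only [Matrix.mul_apply, Matrix.transpose_apply, Finset.sum_mul]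
    rw [Finset.sum_comm]
    conv_rhs => rw [Finset.sum_comm]
    refine Finset.sum_congr rfl fun j _ => ?_
    rw [Finset.sum_comm]
  rw [h1]
  simp only [pd_localMin h, mul_zero, Finset.sum_const_zero, zero_add]
  have := Finset.sum_nonneg fun l (_ : l ∈ (Finset.univ : Finset (Fin r))) =>
    hess_localMin hw h (fun j => σ p j l)
  linarith

lemma Sop_sub {d r : ℕ} (b : (Fin d → ℝ) → Fin d → ℝ)
    (σ : (Fin d → ℝ) → Matrix (Fin d) (Fin r) ℝ) {u v : (Fin d → ℝ) → ℝ} (ε : ℝ)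
    (hu : ContDiff ℝ 2 u) (hv : ContDiff ℝ 2 v) (x) :
    Sop b σ (fun y => u y - ε * v y) x = Sop b σ u x - ε * Sop b σ v x := by
  have du : Differentiable ℝ u := hu.differentiable (by norm_num)
  have dv : Differentiable ℝ v := hv.differentiable (by norm_num)
  have du1 : ∀ j, Differentiable ℝ (pd u j) := fun j =>
    (pd_contDiff hu (k := 1) (by norm_num) j).differentiable (by norm_num)
  have dv1 : ∀ j, Differentiable ℝ (pd v j) := fun j =>
    (pd_contDiff hv (k := 1) (by norm_num) j).differentiable (by norm_num)
  have e1 : ∀ j y, pd (fun y => u y - ε * v y) j y = pd u j y - ε * pd v j y := by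
    intro j y
    rw [pd_sub (du y) ((dv y).const_mul ε), pd_const_mul (dv y)]
  have e2 : ∀ j k, pd2 (fun y => u y - ε * v y) j k x = pd2 u j k x - ε * pd2 v j k x := by
    intro j k
    unfold pd2
    simp only [e1]
    rw [pd_sub (du1 j x) ((dv1 j x).const_mul ε), pd_const_mul (dv1 j x)]
  unfold Sop
  simp only [e1, e2, mul_sub, Finset.sum_sub_distrib, mul_left_comm _ ε, ← Finset.mul_sum]
  ring

/-- squared Euclidean norm -/
def qf {d : ℕ} (x : Fin d → ℝ) : ℝ := ∑ i, x i ^ 2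

lemma qf_cont {d : ℕ} : Continuous (qf (d := d)) := by unfold qf; fun_prop

lemma qf_nonneg {d : ℕ} (x : Fin d → ℝ) : 0 ≤ qf x := Finset.sum_nonneg fun _ _ => sq_nonneg _

lemma qf_eq_zero {d : ℕ} {x : Fin d → ℝ} (h : qf x ≤ 0) : x = 0 := by
  have h0 : qf x = 0 := le_antisymm h (qf_nonneg x)
  unfold qf at h0
  rw [Finset.sum_eq_zero_iff_of_nonneg fun _ _ => sq_nonneg _] at h0
  ext i
  simpa using h0 i (Finset.mem_univ i)

lemma qf_para {d : ℕ} (x y : Fin d → ℝ) : qf (x + y) + qf (x - y) = 2 * qf x + 2 * qf y := by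
  unfold qf
  rw [← Finset.sum_add_distrib, Finset.mul_sum, Finset.mul_sum, ← Finset.sum_add_distrib]
  refine Finset.sum_congr rfl fun i _ => ?_
  simp only [Pi.add_apply, Pi.sub_apply]; ring

lemma norm_sq_le_qf {d : ℕ} (x : Fin d → ℝ) : ‖x‖ ≤ Real.sqrt (qf x) := by
  rw [pi_norm_le_iff_of_nonneg (Real.sqrt_nonneg _)]
  intro i
  rw [Real.norm_eq_abs]
  apply Real.abs_le_sqrt
  exact Finset.single_le_sum (f := fun i => x i ^ 2) (fun _ _ => sq_nonneg _) (Finset.mem_univ i)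

/-- Hopf barrier -/
def bar {d : ℕ} (lam q0 : ℝ) (y x : Fin d → ℝ) : ℝ :=
  Real.exp (-lam * qf (x - y)) - Real.exp (-lam * q0)

lemma bar_smooth {d : ℕ} (lam q0 : ℝ) (y : Fin d → ℝ) {n : WithTop ℕ∞} :
    ContDiff ℝ n (bar lam q0 y) := by
  unfold bar qf
  simp only [Pi.sub_apply]
  have h : ∀ i : Fin d, ContDiff ℝ n fun x : Fin d → ℝ => x i := fun i => contDiff_apply ℝ ℝ i
  exact (Real.contDiff_exp.comp (contDiff_const.mul (ContDiff.sum fun i _ =>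
    ((h i).sub contDiff_const).pow 2))).sub contDiff_const

lemma hasDerivAt_pd {d : ℕ} {f : (Fin d → ℝ) → ℝ} (hf : Differentiable ℝ f) (x) (j : Fin d) {c : ℝ}
    (h : HasDerivAt (fun t : ℝ => f (x + t • Pi.single j 1)) c 0) : pd f j x = c := by
  have := hasDerivAt_line hf x (Pi.single j 1) 0
  have h2 := this.unique h
  rw [← h2, ← fderiv_eq_pd]
  simp [pd]

lemma qf_line {d : ℕ} (x y : Fin d → ℝ) (j : Fin d) (t : ℝ) :
    qf (x + t • Pi.single j 1 - y) = qf (x - y) + 2 * t * (x j - y j) + t ^ 2 := by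
  unfold qf
  have : ∀ i, (x + t • (Pi.single j (1:ℝ) : Fin d → ℝ) - y) i ^ 2 = (x - y) i ^ 2 +
      (if i = j then 2 * t * (x j - y j) + t ^ 2 else 0) := by
    intro i
    by_cases h : i = j
    · subst h; simp; ring
    · simp [h]
  simp only [this, Finset.sum_add_distrib, Finset.sum_ite_eq', Finset.mem_univ, if_true]
  ring

lemma exp_line {d : ℕ} (lam : ℝ) (y x : Fin d → ℝ) (j : Fin d) :
    HasDerivAt (fun t : ℝ => Real.exp (-lam * qf (x + t • Pi.single j 1 - y)))
      (-2 * lam * (x j - y j) * Real.exp (-lam * qf (x - y))) 0 := by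
  simp only [qf_line]
  have h1 : HasDerivAt (fun t : ℝ => -lam * (qf (x - y) + 2 * t * (x j - y j) + t ^ 2))
      (-lam * (2 * (x j - y j))) 0 := by
    have a1 : HasDerivAt (fun t : ℝ => 2 * t * (x j - y j)) (2 * (x j - y j)) 0 := by
      have := ((hasDerivAt_id (0:ℝ)).const_mul 2).mul_const (x j - y j)
      simpa using this
    have a2 : HasDerivAt (fun t : ℝ => t ^ 2) 0 0 := by
      have := (hasDerivAt_id (0:ℝ)).fun_pow 2
      simpa using this
    have := ((a1.const_add (qf (x - y))).add a2).const_mul (-lam)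
    simpa using this
  have := h1.exp
  convert this using 1
  simp; ring

lemma bar_pd {d : ℕ} (lam q0 : ℝ) (y x : Fin d → ℝ) (j : Fin d) :
    pd (bar lam q0 y) j x = -2 * lam * (x j - y j) * Real.exp (-lam * qf (x - y)) := by
  apply hasDerivAt_pd ((bar_smooth lam q0 y (n := 1)).differentiable (by norm_num))
  exact (exp_line lam y x j).sub_const _

lemma bar_pd2 {d : ℕ} (lam q0 : ℝ) (y x : Fin d → ℝ) (j k : Fin d) :
    pd2 (bar lam q0 y) j k x = (4 * lam ^ 2 * (x j - y j) * (x k - y k)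
      - 2 * lam * (if j = k then 1 else 0)) * Real.exp (-lam * qf (x - y)) := by
  unfold pd2
  apply hasDerivAt_pd
    ((pd_contDiff (bar_smooth lam q0 y (n := 2)) (k := 1) (by norm_num) j).differentiable
      (by norm_num))
  simp only [bar_pd]
  have h1 : HasDerivAt (fun t : ℝ => -2 * lam * ((x + t • (Pi.single k (1:ℝ) : Fin d → ℝ)) j - y j))
      (-2 * lam * (if j = k then 1 else 0)) 0 := by
    have : HasDerivAt (fun t : ℝ => x j + t * (if j = k then 1 else 0) - y j)
        (if j = k then 1 else 0) 0 := by
      have := (((hasDerivAt_id (0:ℝ)).mul_const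
        (if j = k then (1:ℝ) else 0)).const_add (x j)).sub_const (y j)
      simpa using this
    have := this.const_mul (-2 * lam)
    simpa [Pi.single_apply] using this
  have h3 := h1.fun_mul (exp_line lam y x k)
  have e : (4 * lam ^ 2 * (x j - y j) * (x k - y k)
      - 2 * lam * (if j = k then 1 else 0)) * Real.exp (-lam * qf (x - y))
      = (-2 * lam * if j = k then 1 else 0)
          * Real.exp (-lam * qf (x + (0:ℝ) • Pi.single k 1 - y)) +
        -2 * lam * ((x + (0:ℝ) • (Pi.single k (1:ℝ) : Fin d → ℝ)) j - y j)
          * (-2 * lam * (x k - y k) * Real.exp (-lam * qf (x - y))) := by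
    rw [zero_smul, add_zero]; ring
  rw [e]
  exact h3

lemma bar_Sop {d r : ℕ} (b : (Fin d → ℝ) → Fin d → ℝ)
    (σ : (Fin d → ℝ) → Matrix (Fin d) (Fin r) ℝ) (lam q0 : ℝ) (y x : Fin d → ℝ) :
    Sop b σ (bar lam q0 y) x = Real.exp (-lam * qf (x - y)) *
      (2 * lam ^ 2 * ((x - y) ⬝ᵥ ((σ x * (σ x)ᵀ) *ᵥ (x - y)))
        - lam * (2 * ∑ j, b x j * (x j - y j) + ∑ j, (σ x * (σ x)ᵀ) j j)) := by
  unfold Sop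
  simp only [bar_pd, bar_pd2, dotProduct, mulVec, Pi.sub_apply]
  generalize Real.exp (-lam * qf (x - y)) = e
  generalize σ x * (σ x)ᵀ = A
  have h1 : ∑ j, b x j * (-2 * lam * (x j - y j) * e) = -2 * lam * e * ∑ j, b x j * (x j - y j) := by
    rw [Finset.mul_sum]; exact Finset.sum_congr rfl fun j _ => by ring
  have h2 : ∑ j, ∑ k, A j k * ((4 * lam ^ 2 * (x j - y j) * (x k - y k)
      - 2 * lam * (if j = k then 1 else 0)) * e)
      = 4 * lam ^ 2 * e * ∑ j, (x j - y j) * ∑ k, A j k * (x k - y k)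
        - 2 * lam * e * ∑ j, A j j := by
    rw [Finset.mul_sum, Finset.mul_sum, ← Finset.sum_sub_distrib]
    refine Finset.sum_congr rfl fun j _ => ?_
    have : ∀ k, A j k * ((4 * lam ^ 2 * (x j - y j) * (x k - y k)
      - 2 * lam * (if j = k then 1 else 0)) * e)
      = 4 * lam ^ 2 * e * (x j - y j) * (A j k * (x k - y k))
        - (if j = k then 2 * lam * e * A j k else 0) := by
      intro k; split_ifs <;> ring
    simp only [this, Finset.sum_sub_distrib, Finset.sum_ite_eq, Finset.mem_univ, if_true,
      ← Finset.mul_sum]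
    ring
  rw [h1, h2]; ring

/-- Strong minimum principle. -/
lemma strong_min {d r : ℕ} (b : (Fin d → ℝ) → Fin d → ℝ)
    (σ : (Fin d → ℝ) → Matrix (Fin d) (Fin r) ℝ) (c : (Fin d → ℝ) → ℝ)
    (hb : ∀ j, Continuous fun x => b x j) (hσ : ∀ i j, Continuous fun x => σ x i j)
    (hc : Continuous c) (hc0 : ∀ x, 0 ≤ c x) {amin : ℝ} (ham : 0 < amin)
    (hell : ∀ x ξ : Fin d → ℝ, amin * ∑ i, ξ i ^ 2 ≤ ξ ⬝ᵥ ((σ x * (σ x)ᵀ) *ᵥ ξ))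
    {u : (Fin d → ℝ) → ℝ} (hu : ContDiff ℝ 2 u) (hu0 : ∀ x, 0 ≤ u x)
    (hLu : ∀ x, Sop b σ u x - c x * u x ≤ 0) {z0} (hz0 : u z0 = 0) (x) : u x = 0 := by
  by_contra hx
  -- closest zero
  obtain ⟨z, hz, hzmin⟩ : ∃ z, u z = 0 ∧ ∀ z', u z' = 0 → qf (z - x) ≤ qf (z' - x) := by
    set K := {z | u z = 0} ∩ Metric.closedBall x (Real.sqrt (qf (z0 - x))) with hK
    have hKc : IsCompact K := (isCompact_closedBall _ _).inter_left
      (isClosed_eq hu.continuous continuous_const)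
    have hmem : ∀ z', u z' = 0 → qf (z' - x) ≤ qf (z0 - x) → z' ∈ K := by
      intro z' h1 h2
      refine ⟨h1, ?_⟩
      rw [Metric.mem_closedBall, dist_eq_norm]
      exact (norm_sq_le_qf _).trans (Real.sqrt_le_sqrt h2)
    obtain ⟨z, hzK, hzm⟩ := hKc.exists_isMinOn ⟨z0, hmem z0 hz0 le_rfl⟩
      (f := fun z => qf (z - x)) (qf_cont.comp (continuous_id.sub continuous_const)).continuousOn
    refine ⟨z, hzK.1, fun z' hz' => ?_⟩
    rcases le_total (qf (z' - x)) (qf (z0 - x)) with h | h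
    · exact hzm (hmem z' hz' h)
    · exact (hzm (hmem z0 hz0 le_rfl)).trans h
  have hzx : z ≠ x := fun h => hx (h ▸ hz)
  -- midpoint
  set y : Fin d → ℝ := (1/2 : ℝ) • (x + z) with hy
  set q0 := qf (z - y) with hq0
  have hzy : z - x = (z - y) + (z - y) := by
    ext i; simp only [hy, Pi.sub_apply, Pi.add_apply, Pi.smul_apply, smul_eq_mul]; ring
  have hq0pos : 0 < q0 := by
    rcases (qf_nonneg (z - y)).lt_or_eq with h | h
    · exact h
    · exfalso
      have h1 := qf_eq_zero h.symm.le
      rw [h1, add_zero, sub_eq_zero] at hzy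
      exact hzx hzy
  have htouch : ∀ p, qf (p - y) ≤ q0 → u p = 0 → p = z := by
    intro p hp1 hp2
    have h1 := hzmin p hp2
    have h2 : p - x = (p - y) + (z - y) := by
      ext i; simp only [hy, Pi.sub_apply, Pi.add_apply, Pi.smul_apply, smul_eq_mul]; ring
    have h3 := qf_para (p - y) (z - y)
    have h4 := qf_para (z - y) (z - y)
    have h5 : qf (z - y - (z - y)) = 0 := by simp [qf]
    rw [hzy, h2] at h1
    have h6 : qf (p - y - (z - y)) ≤ 0 := by linarith
    have h7 := qf_eq_zero h6
    rw [sub_sub_sub_cancel_right, sub_eq_zero] at h7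
    exact h7
  -- small ball
  have hqc : Continuous fun p => qf (p - y) := qf_cont.comp (continuous_id.sub continuous_const)
  obtain ⟨ρ, hρ, hball⟩ : ∃ ρ > 0, ∀ p ∈ Metric.closedBall z ρ, q0 / 4 ≤ qf (p - y) := by
    have h1 : ∀ᶠ p in 𝓝 z, q0 / 4 < qf (p - y) :=
      hqc.continuousAt.eventually (lt_mem_nhds (show q0 / 4 < qf (z - y) by linarith))
    obtain ⟨ρ, hρ, h⟩ := Metric.nhds_basis_closedBall.eventually_iff.1 h1
    exact ⟨ρ, hρ, fun p hp => (h hp).le⟩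
  have hAc : ∀ j k, Continuous fun x => (σ x * (σ x)ᵀ) j k := by
    intro j k
    simp only [Matrix.mul_apply, Matrix.transpose_apply]
    exact continuous_finsetSum _ fun l _ => (hσ j l).mul (hσ k l)
  obtain ⟨B1, hB1⟩ := (isCompact_closedBall z ρ).exists_bound_of_continuousOn
    (f := fun p => 2 * ∑ j, b p j * (p j - y j) + ∑ j, (σ p * (σ p)ᵀ) j j)
    (Continuous.continuousOn (by
      refine (continuous_const.mul (continuous_finsetSum _ fun j _ =>
        (hb j).mul ((continuous_apply j).sub continuous_const))).add
        (continuous_finsetSum _ fun j _ => hAc j j)))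
  obtain ⟨B2, hB2⟩ := (isCompact_closedBall z ρ).exists_bound_of_continuousOn hc.continuousOn
  set B := max (max B1 B2) 0 with hB
  have hB0 : 0 ≤ B := le_max_right _ _
  set κ := amin * (q0 / 4) with hκ
  have hκ0 : 0 < κ := by positivity
  set lam := (B + 1) / κ + 1 with hlam
  have hlam1 : 1 ≤ lam := by
    have : 0 ≤ (B + 1) / κ := by positivity
    linarith
  have hlamκ : B + 1 ≤ lam * κ := by
    rw [hlam, add_mul, div_mul_cancel₀ _ hκ0.ne']
    linarith
  set v := bar lam q0 y with hv
  have hvLpos : ∀ p ∈ Metric.closedBall z ρ, 0 < Sop b σ v p - c p * v p := by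
    intro p hp
    rw [hv, bar_Sop]
    have h1 : κ ≤ (p - y) ⬝ᵥ ((σ p * (σ p)ᵀ) *ᵥ (p - y)) :=
      le_trans (mul_le_mul_of_nonneg_left (hball p hp) ham.le) (hell p (p - y))
    have h2 : 2 * ∑ j, b p j * (p j - y j) + ∑ j, (σ p * (σ p)ᵀ) j j ≤ B :=
      (le_abs_self _).trans ((hB1 p hp).trans ((le_max_left _ _).trans (le_max_left _ _)))
    have h3 : c p ≤ B :=
      (le_abs_self _).trans ((hB2 p hp).trans ((le_max_right _ _).trans (le_max_left _ _)))
    have h4 := Real.exp_pos (-lam * qf (p - y))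
    have h5 := Real.exp_pos (-lam * q0)
    have h6 : c p * bar lam q0 y p ≤ B * Real.exp (-lam * qf (p - y)) := by
      unfold bar
      calc c p * (Real.exp (-lam * qf (p - y)) - Real.exp (-lam * q0))
          ≤ c p * Real.exp (-lam * qf (p - y)) :=
            mul_le_mul_of_nonneg_left (by linarith) (hc0 p)
        _ ≤ _ := mul_le_mul_of_nonneg_right h3 h4.le
    generalize (p - y) ⬝ᵥ ((σ p * (σ p)ᵀ) *ᵥ (p - y)) = S at *
    generalize 2 * ∑ j, b p j * (p j - y j) + ∑ j, (σ p * (σ p)ᵀ) j j = T at *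
    have h7 : B < 2 * lam ^ 2 * S - lam * T := by
      have g1 : lam * T ≤ lam * B := mul_le_mul_of_nonneg_left h2 (by linarith)
      have g2 : lam * (lam * κ) ≤ lam * (lam * S) := by gcongr
      have g3 : lam * (B + 1) ≤ lam * (lam * κ) := by gcongr
      nlinarith
    have := mul_lt_mul_of_pos_left h7 h4
    linarith
  -- choice of ε
  obtain ⟨δ, hδ, hδu⟩ : ∃ δ > 0, ∀ p ∈ Metric.sphere z ρ ∩ {p | qf (p - y) ≤ q0}, δ ≤ u p := by
    refine IsCompact.exists_forall_le' ((isCompact_sphere z ρ).inter_right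
      (isClosed_le hqc continuous_const)) hu.continuous.continuousOn ?_
    rintro p ⟨hp1, hp2⟩
    refine lt_of_le_of_ne (hu0 p) fun h => ?_
    have := htouch p hp2 h.symm
    rw [this, Metric.mem_sphere, dist_self] at hp1
    exact hρ.ne hp1
  have hvc : ContDiff ℝ 2 v := bar_smooth _ _ _
  set w : (Fin d → ℝ) → ℝ := fun p => u p - δ * v p with hw
  have hwc : ContDiff ℝ 2 w := hu.sub (contDiff_const.mul hvc)
  have hwS : ∀ p ∈ Metric.sphere z ρ, 0 < w p := by
    intro p hp
    rcases le_or_gt (qf (p - y)) q0 with h | h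
    · have h1 := hδu p ⟨hp, h⟩
      have h2 : v p < 1 := by
        have a1 : Real.exp (-lam * qf (p - y)) ≤ 1 := by
          rw [Real.exp_le_one_iff]
          have := qf_nonneg (p - y)
          nlinarith
        have a2 := Real.exp_pos (-lam * q0)
        simp only [hv, bar]; linarith
      have : δ * v p < δ * 1 := mul_lt_mul_of_pos_left h2 hδ
      simp only [hw]; linarith
    · have h2 : v p < 0 := by
        simp only [hv, bar, sub_neg]
        apply Real.exp_lt_exp.2
        nlinarith
      have : δ * v p < 0 := mul_neg_of_pos_of_neg hδ h2
      have := hu0 p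
      simp only [hw]; linarith
  obtain ⟨p, hpB, hpmin⟩ := (isCompact_closedBall z ρ).exists_isMinOn
    ⟨z, Metric.mem_closedBall_self hρ.le⟩ hwc.continuous.continuousOn
  have hwz : w z = 0 := by simp [hw, hz, hv, bar, hq0]
  have hwp : w p ≤ 0 := hwz ▸ hpmin (Metric.mem_closedBall_self hρ.le)
  have hpint : p ∈ Metric.ball z ρ := by
    rw [Metric.mem_ball]
    refine lt_of_le_of_ne hpB fun h => ?_
    exact absurd (hwS p h) (not_lt.2 hwp)
  have hloc : IsLocalMin w p := hpmin.isLocalMin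
    (mem_of_superset (Metric.isOpen_ball.mem_nhds hpint) Metric.ball_subset_closedBall)
  have k1 := Sop_localMin b σ hwc hloc
  rw [hw, Sop_sub b σ δ hu hvc] at k1
  have k2 := hLu p
  have k3 := mul_pos hδ (hvLpos p hpB)
  have k4 : c p * w p ≤ 0 := mul_nonpos_of_nonneg_of_nonpos (hc0 p) hwp
  simp only [hw] at k4
  nlinarith

end Part6

section Part7
open MeasureTheory Matrix Finset Filter Topology
lemma jumpOp_eq {d m : ℕ} {q : Fin m → Fin m → (Fin d → ℝ) → ℝ}
    (hq_diag : ∀ α x, q α α x = -∑ β ∈ Finset.univ.filter (fun β => β ≠ α), q α β x)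
    (f : (Fin d → ℝ) → Fin m → ℝ) (x α) : jumpOp q f x α = ∑ β, q α β x * f x β := by
  unfold jumpOp
  have h1 : ∑ β, q α β x * f x β
      = q α α x * f x α + ∑ β ∈ Finset.univ.filter (fun β => β ≠ α), q α β x * f x β := by
    rw [Finset.filter_ne', Finset.add_sum_erase _ (fun β => q α β x * f x β) (Finset.mem_univ α)]
  rw [h1, hq_diag]
  simp only [mul_sub, Finset.sum_sub_distrib, ← Finset.sum_mul]
  ring

lemma gen_eq_Sop {d r m : ℕ} (b : (Fin d → ℝ) → Fin m → Fin d → ℝ)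
    (σ : (Fin d → ℝ) → Fin m → Matrix (Fin d) (Fin r) ℝ)
    (q : Fin m → Fin m → (Fin d → ℝ) → ℝ) (f : (Fin d → ℝ) → Fin m → ℝ) (x α) :
    gen b (diffMat σ) q f x α
      = Sop (fun y => b y α) (fun y => σ y α) (fun y => f y α) x + jumpOp q f x α := rfl

lemma gen_const {d r m : ℕ} (hm : 0 < m)
    (b : (Fin d → ℝ) → Fin m → Fin d → ℝ)
    (σ : (Fin d → ℝ) → Fin m → Matrix (Fin d) (Fin r) ℝ)
    (q : Fin m → Fin m → (Fin d → ℝ) → ℝ)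
    (amin : ℝ) (hamin : 0 < amin)
    (hb : ∀ α j, Continuous fun x => b x α j)
    (hσ : ∀ α i j, Continuous fun x => σ x α i j)
    (hell : ∀ (x ξ : Fin d → ℝ) (α : Fin m),
      amin * ∑ i, ξ i ^ 2 ≤ ξ ⬝ᵥ (diffMat σ x α *ᵥ ξ))
    (hq_smooth : ∀ α β, α ≠ β → Continuous (q α β))
    (hq_nonneg : ∀ α β, α ≠ β → ∀ x, 0 ≤ q α β x)
    (hq_irred : ∀ (x : Fin d → ℝ) (B : Set (Fin m)), B.Nonempty → Bᶜ.Nonempty →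
      ∃ α ∈ B, ∃ β ∈ Bᶜ, q α β x ≠ 0)
    (Φ : (Fin d → ℝ) → Fin m → ℝ) (hΦ : ∀ α, ContDiff ℝ 2 fun x => Φ x α)
    (hper : ∀ α, Per fun x => Φ x α)
    (h0 : ∀ x α, gen b (diffMat σ) q Φ x α = 0) : ∃ c, ∀ x α, Φ x α = c := by
  classical
  -- maximum
  obtain ⟨x0, α0, hmax⟩ : ∃ x0 α0, ∀ x α, Φ x α ≤ Φ x0 α0 := by
    have h1 : ∀ α, ∃ x0, ∀ x, Φ x α ≤ Φ x0 α := by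
      intro α
      obtain ⟨x0, -, hx0⟩ := (isCompact_Icc (a := (0 : Fin d → ℝ)) (b := 1)).exists_isMaxOn
        ⟨0, by simp⟩ (hΦ α).continuous.continuousOn
      refine ⟨x0, fun x => ?_⟩
      have h2 : (fun i => Int.fract (x i)) ∈ Set.Icc (0 : Fin d → ℝ) 1 :=
        ⟨fun i => Int.fract_nonneg _, fun i => (Int.fract_lt_one _).le⟩
      have h3 := hx0 h2
      have h4 := per_fract (hper α) x
      exact h4.symm.le.trans h3
    choose X hX using h1
    obtain ⟨α0, -, hα0⟩ := Finset.exists_max_image (Finset.univ : Finset (Fin m))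
      (fun α => Φ (X α) α) ⟨⟨0, hm⟩, Finset.mem_univ _⟩
    exact ⟨X α0, α0, fun x α => (hX α x).trans (hα0 α (Finset.mem_univ _))⟩
  set M0 := Φ x0 α0 with hM0
  have key : ∀ α z, Φ z α = M0 → ∀ x, Φ x α = M0 := by
    intro α z hz x
    have hu : ContDiff ℝ 2 fun y => M0 - 1 * Φ y α := contDiff_const.sub (contDiff_const.mul (hΦ α))
    have := strong_min (fun y => b y α) (fun y => σ y α)
      (fun y => ∑ β ∈ Finset.univ.filter (fun β => β ≠ α), q α β y)
      (hb α) (hσ α)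
      (continuous_finsetSum _ fun β hβ => hq_smooth α β (Finset.mem_filter.1 hβ).2.symm)
      (fun y => Finset.sum_nonneg fun β hβ => hq_nonneg α β (Finset.mem_filter.1 hβ).2.symm y)
      hamin (fun y ξ => hell y ξ α) hu (fun y => by linarith [hmax y α]) ?_
      (z0 := z) (by linarith) x
    · linarith
    · intro y
      rw [Sop_sub _ _ 1 contDiff_const (hΦ α)]
      have h1 := h0 y α
      rw [gen_eq_Sop] at h1
      have h2 : Sop (fun y => b y α) (fun y => σ y α) (fun _ => M0) y = 0 := by
        unfold Sop pd2
        simp [pd_const]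
      rw [h2]
      have h3 : jumpOp q Φ y α ≤ (∑ β ∈ Finset.univ.filter (fun β => β ≠ α), q α β y)
          * (M0 - 1 * Φ y α) := by
        unfold jumpOp
        rw [Finset.sum_mul]
        refine Finset.sum_le_sum fun β hβ => ?_
        refine mul_le_mul_of_nonneg_left ?_ (hq_nonneg α β (Finset.mem_filter.1 hβ).2.symm y)
        linarith [hmax y β]
      linarith
  refine ⟨M0, ?_⟩
  by_contra hne
  push Not at hne
  obtain ⟨x1, α1, h1⟩ := hne
  obtain ⟨α, hα, β, hβ, hqne⟩ := hq_irred 0 {α | ∀ x, Φ x α = M0} ⟨α0, key α0 x0 rfl⟩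
    ⟨α1, fun h => h1 (h x1)⟩
  apply hβ
  have hαβ : α ≠ β := fun h => hβ (h ▸ hα)
  refine key β 0 ?_
  have g1 := h0 0 α
  rw [gen_eq_Sop] at g1
  have hα' : (fun y => Φ y α) = fun _ => M0 := funext hα
  have h2 : Sop (fun y => b y α) (fun y => σ y α) (fun y => Φ y α) 0 = 0 := by
    rw [hα']
    unfold Sop pd2
    simp [pd_const]
  rw [h2, zero_add] at g1
  unfold jumpOp at g1
  rw [Finset.sum_eq_zero_iff_of_nonpos] at g1
  · have := g1 β (by simp [hαβ.symm])
    rcases mul_eq_zero.1 this with h | h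
    · exact absurd h hqne
    · have := hα 0
      linarith
  · intro γ hγ
    refine mul_nonpos_of_nonneg_of_nonpos (hq_nonneg α γ (Finset.mem_filter.1 hγ).2.symm 0) ?_
    have := hα 0
    linarith [hmax 0 γ]

/-! duality -/

lemma tInt_parts {d : ℕ} {f g : (Fin d → ℝ) → ℝ} (hf : ContDiff ℝ 1 f) (hg : ContDiff ℝ 1 g)
    (pf : Per f) (pg : Per g) (j : Fin d) :
    tInt (fun x => pd f j x * g x) = - tInt (fun x => f x * pd g j x) := by
  have h := tInt_pd (hf.mul hg) (per_mul pf pg) j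
  have e : pd (fun y => f y * g y) j = fun x => f x * pd g j x + pd f j x * g x := by
    ext x
    rw [pd_mul (hf.differentiable (by norm_num) x) (hg.differentiable (by norm_num) x)]
    ring
  have c1 : Continuous (pd f j) := (pd_contDiff hf (k := 0) (by norm_num) j).continuous
  have c2 : Continuous (pd g j) := (pd_contDiff hg (k := 0) (by norm_num) j).continuous
  have c3 : Continuous fun x => f x * pd g j x := hf.continuous.mul c2
  have c4 : Continuous fun x => pd f j x * g x := c1.mul hg.continuous
  rw [e, tInt_add c3 c4] at h
  linarith

lemma pd2_cont {d : ℕ} {f : (Fin d → ℝ) → ℝ} (hf : ContDiff ℝ 2 f) (j k : Fin d) :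
    Continuous (pd2 f j k) :=
  (pd_contDiff (pd_contDiff hf (k := 1) (by norm_num) j) (k := 0) (by norm_num) k).continuous

lemma pd_cont {d : ℕ} {f : (Fin d → ℝ) → ℝ} (hf : ContDiff ℝ 2 f) (j : Fin d) :
    Continuous (pd f j) :=
  (pd_contDiff hf (k := 1) (by norm_num) j).continuous

lemma scal_dual {d : ℕ} {b : Fin d → (Fin d → ℝ) → ℝ} {a : Fin d → Fin d → (Fin d → ℝ) → ℝ}
    (hb : ∀ j, ContDiff ℝ 2 (b j)) (ha : ∀ j k, ContDiff ℝ 2 (a j k))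
    (pb : ∀ j, Per (b j)) (pa : ∀ j k, Per (a j k))
    {f g : (Fin d → ℝ) → ℝ} (hf : ContDiff ℝ 2 f) (hg : ContDiff ℝ 2 g)
    (pf : Per f) (pg : Per g) :
    tInt (fun x => ((∑ j, b j x * pd f j x) + (1/2) * ∑ j, ∑ k, a j k x * pd2 f j k x) * g x)
      = tInt (fun x => f x * (-(∑ j, pd (fun y => b j y * g y) j x)
          + (1/2) * ∑ j, ∑ k, pd2 (fun y => a j k y * g y) j k x)) := by
  have o2 : (1 : WithTop ℕ∞) ≤ 2 := by norm_num
  have T1 : ∀ j, tInt (fun x => b j x * pd f j x * g x)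
      = - tInt (fun x => f x * pd (fun y => b j y * g y) j x) := by
    intro j
    rw [← tInt_parts (hf.of_le o2) (((hb j).mul hg).of_le o2) pf (per_mul (pb j) pg)]
    congr 1; ext x; ring
  have T2 : ∀ j k, tInt (fun x => a j k x * pd2 f j k x * g x)
      = tInt (fun x => f x * pd2 (fun y => a j k y * g y) j k x) := by
    intro j k
    have hag := (ha j k).mul hg
    have pag := per_mul (pa j k) pg
    have e1 := tInt_parts (pd_contDiff hf (k := 1) (by norm_num) j) (hag.of_le o2)
      (pd_per pf j) pag k
    have e2 := tInt_parts (hf.of_le o2) (pd_contDiff hag (k := 1) (by norm_num) k)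
      pf (pd_per pag k) j
    calc tInt (fun x => a j k x * pd2 f j k x * g x)
        = tInt (fun x => pd (pd f j) k x * (a j k x * g x)) := by
          congr 1; ext x; unfold pd2; ring
      _ = _ := by
          rw [e1, e2, neg_neg]
          congr 1; ext x
          rw [pd_comm hag]; rfl
  have cb : ∀ j, Continuous fun x => b j x * pd f j x * g x := fun j =>
    ((hb j).continuous.mul (pd_cont hf j)).mul hg.continuous
  have ca : ∀ j k, Continuous fun x => a j k x * pd2 f j k x * g x := fun j k =>
    ((ha j k).continuous.mul (pd2_cont hf j k)).mul hg.continuous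
  have cb' : ∀ j, Continuous fun x => f x * pd (fun y => b j y * g y) j x := fun j =>
    hf.continuous.mul (pd_cont ((hb j).mul hg) j)
  have ca' : ∀ j k, Continuous fun x => f x * pd2 (fun y => a j k y * g y) j k x := fun j k =>
    hf.continuous.mul (pd2_cont ((ha j k).mul hg) j k)
  have L : tInt (fun x => ((∑ j, b j x * pd f j x)
      + (1/2) * ∑ j, ∑ k, a j k x * pd2 f j k x) * g x)
      = (∑ j, tInt (fun x => b j x * pd f j x * g x))
        + (1/2) * ∑ j, ∑ k, tInt (fun x => a j k x * pd2 f j k x * g x) := by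
    have : (fun x => ((∑ j, b j x * pd f j x)
      + (1/2) * ∑ j, ∑ k, a j k x * pd2 f j k x) * g x)
      = fun x => (∑ j, b j x * pd f j x * g x) + (1/2) * ∑ j, ∑ k, a j k x * pd2 f j k x * g x := by
      ext x
      rw [add_mul, mul_assoc]
      simp only [Finset.sum_mul]
    have c1 : Continuous fun x => ∑ j, b j x * pd f j x * g x :=
      continuous_finsetSum _ fun j _ => cb j
    have c2 : Continuous fun x => (1/2) * ∑ j, ∑ k, a j k x * pd2 f j k x * g x :=
      continuous_const.mul (continuous_finsetSum _ fun j _ =>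
        continuous_finsetSum _ fun k _ => ca j k)
    rw [this, tInt_add c1 c2, tInt_const_mul, tInt_sum _ cb,
      tInt_sum _ fun j => continuous_finsetSum _ fun k _ => ca j k]
    simp only [tInt_sum _ (ca _)]
  have R : tInt (fun x => f x * (-(∑ j, pd (fun y => b j y * g y) j x)
          + (1/2) * ∑ j, ∑ k, pd2 (fun y => a j k y * g y) j k x))
      = (-1) * (∑ j, tInt (fun x => f x * pd (fun y => b j y * g y) j x))
        + (1/2) * ∑ j, ∑ k, tInt (fun x => f x * pd2 (fun y => a j k y * g y) j k x) := by
    have : (fun x => f x * (-(∑ j, pd (fun y => b j y * g y) j x)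
          + (1/2) * ∑ j, ∑ k, pd2 (fun y => a j k y * g y) j k x))
      = fun x => (-1) * (∑ j, f x * pd (fun y => b j y * g y) j x)
        + (1/2) * ∑ j, ∑ k, f x * pd2 (fun y => a j k y * g y) j k x := by
      ext x
      simp only [← Finset.mul_sum]
      ring
    have c1 : Continuous fun x => (-1) * (∑ j, f x * pd (fun y => b j y * g y) j x) :=
      continuous_const.mul (continuous_finsetSum _ fun j _ => cb' j)
    have c2 : Continuous fun x => (1/2) * ∑ j, ∑ k, f x * pd2 (fun y => a j k y * g y) j k x :=
      continuous_const.mul (continuous_finsetSum _ fun j _ =>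
        continuous_finsetSum _ fun k _ => ca' j k)
    rw [this, tInt_add c1 c2, tInt_const_mul, tInt_const_mul, tInt_sum _ cb',
      tInt_sum _ fun j => continuous_finsetSum _ fun k _ => ca' j k]
    simp only [tInt_sum _ (ca' _)]
  rw [L, R]
  simp only [T1, T2, Finset.sum_neg_distrib]
  ring

lemma duality {d m : ℕ}
    (b : (Fin d → ℝ) → Fin m → Fin d → ℝ)
    (a : (Fin d → ℝ) → Fin m → Matrix (Fin d) (Fin d) ℝ)
    (q : Fin m → Fin m → (Fin d → ℝ) → ℝ)
    (hb : ∀ α j, ContDiff ℝ 2 fun x => b x α j)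
    (ha : ∀ α i j, ContDiff ℝ 2 fun x => a x α i j)
    (hq : ∀ α β, Continuous (q α β))
    (hq_diag : ∀ α x, q α α x = -∑ β ∈ Finset.univ.filter (fun β => β ≠ α), q α β x)
    (hb_per : ∀ α j, Per fun x => b x α j)
    (ha_per : ∀ α i j, Per fun x => a x α i j)
    (M Φ : (Fin d → ℝ) → Fin m → ℝ)
    (hM_C2 : ∀ α, ContDiff ℝ 2 fun x => M x α) (hM_per : ∀ α, Per fun x => M x α)
    (hC2 : ∀ α, ContDiff ℝ 2 fun x => Φ x α) (hper : ∀ α, Per fun x => Φ x α) :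
    ∑ α, tInt (fun x => gen b a q Φ x α * M x α)
      = ∑ α, tInt (fun x => Φ x α * genAdj b a q M x α) := by
  have cM := fun α => (hM_C2 α).continuous
  have cΦ := fun α => (hC2 α).continuous
  have cJ : ∀ α, Continuous fun x => (∑ β, q α β x * Φ x β) * M x α := fun α =>
    (continuous_finsetSum _ fun β _ => (hq α β).mul (cΦ β)).mul (cM α)
  have cJ' : ∀ α, Continuous fun x => Φ x α * ∑ β, q β α x * M x β := fun α =>
    (cΦ α).mul (continuous_finsetSum _ fun β _ => (hq β α).mul (cM β))
  have hJ : ∑ α, tInt (fun x => (∑ β, q α β x * Φ x β) * M x α)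
      = ∑ α, tInt (fun x => Φ x α * ∑ β, q β α x * M x β) := by
    rw [← tInt_sum _ cJ, ← tInt_sum _ cJ']
    congr 1; ext x
    simp only [Finset.sum_mul, Finset.mul_sum]
    rw [Finset.sum_comm]
    refine Finset.sum_congr rfl fun α _ => Finset.sum_congr rfl fun β _ => by ring
  have h1 : ∀ α, tInt (fun x => gen b a q Φ x α * M x α)
      = tInt (fun x => ((∑ j, b x α j * pd (fun y => Φ y α) j x)
          + (1/2) * ∑ j, ∑ k, a x α j k * pd2 (fun y => Φ y α) j k x) * M x α)
        + tInt (fun x => (∑ β, q α β x * Φ x β) * M x α) := by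
    intro α
    rw [← tInt_add _ (cJ α)]
    · congr 1; ext x
      rw [gen, jumpOp_eq hq_diag]; ring
    · refine (Continuous.add (continuous_finsetSum _ fun j _ => (hb α j).continuous.mul
        (pd_cont (hC2 α) j)) (continuous_const.mul (continuous_finsetSum _ fun j _ =>
        continuous_finsetSum _ fun k _ => (ha α j k).continuous.mul
          (pd2_cont (hC2 α) j k)))).mul (cM α)
  have h2 : ∀ α, tInt (fun x => Φ x α * genAdj b a q M x α)
      = tInt (fun x => Φ x α * (-(∑ j, pd (fun y => b y α j * M y α) j x)
          + (1/2) * ∑ j, ∑ k, pd2 (fun y => a y α j k * M y α) j k x))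
        + tInt (fun x => Φ x α * ∑ β, q β α x * M x β) := by
    intro α
    rw [← tInt_add _ (cJ' α)]
    · congr 1; ext x
      rw [genAdj]; ring
    · refine (cΦ α).mul (Continuous.add (Continuous.neg (continuous_finsetSum _ fun j _ =>
        pd_cont ((hb α j).mul (hM_C2 α)) j)) (continuous_const.mul (continuous_finsetSum _ fun j _ =>
        continuous_finsetSum _ fun k _ => pd2_cont ((ha α j k).mul (hM_C2 α)) j k)))
  simp only [h1, h2, Finset.sum_add_distrib, hJ]
  congr 1
  exact Finset.sum_congr rfl fun α _ => scal_dual (hb α) (ha α) (hb_per α) (ha_per α)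
    (hC2 α) (hM_C2 α) (hper α) (hM_per α)

end Part7

section Part8
open MeasureTheory Matrix Finset Filter Topology
/-- Sobolev multiplier of an eigenfunction. -/
def mu {d : ℕ} (ω : Fin d → ℝ) : ℕ → ℝ
  | 0 => 1
  | k+1 => 1 + mu ω k * ∑ j, ω j ^ 2

lemma mu_pos {d : ℕ} (ω : Fin d → ℝ) (k : ℕ) : 0 < mu ω k := by
  induction k with
  | zero => exact one_pos
  | succ k ih =>
    have : 0 ≤ ∑ j, ω j ^ 2 := Finset.sum_nonneg fun _ _ => sq_nonneg _
    simp only [mu]; positivity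

lemma ip_eig {d : ℕ} (ω : Fin d → ℝ) (k : ℕ) (w e : SP d)
    (he : ∀ j, SP.D j (SP.D j e) = (-(ω j ^ 2)) • e) :
    SP.ip k w e = mu ω k * SP.I (w * e) := by
  induction k generalizing w e with
  | zero => rw [SP.ip_zero, mu, one_mul]
  | succ k ih =>
    rw [SP.ip_succ, SP.ip_zero, mu]
    have h : ∀ j, SP.ip k (SP.D j w) (SP.D j e) = mu ω k * ω j ^ 2 * SP.I (w * e) := by
      intro j
      rw [ih (SP.D j w) (SP.D j e)]
      · rw [mul_comm (SP.D j w), SP.I_parts, he, mul_smul_comm, map_smul, smul_eq_mul]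
        ring
      · intro i
        rw [SP.D_comm i j e, SP.D_comm i j (SP.D i e), he, map_smul]
    simp only [h, ← Finset.sum_mul, ← Finset.mul_sum]
    ring

/-- phase -/
def phase {d : ℕ} (n : Fin d → ℤ) (x : Fin d → ℝ) : ℝ := ∑ i, (2 * Real.pi * n i) * x i

lemma phase_smooth {d : ℕ} (n : Fin d → ℤ) {k : WithTop ℕ∞} : ContDiff ℝ k (phase n) := by
  unfold phase
  exact ContDiff.sum fun i _ => contDiff_const.mul (contDiff_apply ℝ ℝ i)

lemma phase_add {d : ℕ} (n ν : Fin d → ℤ) (x : Fin d → ℝ) :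
    phase n (x + fun i => (ν i : ℝ)) = phase n x + ((∑ i, n i * ν i : ℤ) : ℝ) * (2 * Real.pi) := by
  unfold phase
  push_cast
  rw [Finset.sum_mul, ← Finset.sum_add_distrib]
  refine Finset.sum_congr rfl fun i _ => ?_
  simp only [Pi.add_apply]; ring

lemma phase_line {d : ℕ} (n : Fin d → ℤ) (x : Fin d → ℝ) (j : Fin d) :
    HasDerivAt (fun t : ℝ => phase n (x + t • Pi.single j 1)) (2 * Real.pi * n j) 0 := by
  have h := hasDerivAt_line ((phase_smooth n (k := 1)).differentiable (by norm_num)) x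
    (Pi.single j 1) 0
  have e : ∀ t : ℝ, phase n (x + t • Pi.single j 1) = phase n x + t * (2 * Real.pi * n j) := by
    intro t
    unfold phase
    simp only [Pi.add_apply, Pi.smul_apply, smul_eq_mul, mul_add, Finset.sum_add_distrib]
    congr 1
    rw [Finset.sum_eq_single j]
    · simp; ring
    · intro i _ hij; simp [hij]
    · simp
  simp only [e]
  have := ((hasDerivAt_id (0:ℝ)).mul_const (2 * Real.pi * n j)).const_add (phase n x)
  simpa using this

/-- cosine mode -/
def ec {d : ℕ} (n : Fin d → ℤ) : SP d :=
  ⟨fun x => Real.cos (phase n x), Real.contDiff_cos.comp (phase_smooth n), fun x ν => by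
    show Real.cos _ = Real.cos _
    rw [phase_add, Real.cos_add_int_mul_two_pi]⟩

/-- sine mode -/
def es {d : ℕ} (n : Fin d → ℤ) : SP d :=
  ⟨fun x => Real.sin (phase n x), Real.contDiff_sin.comp (phase_smooth n), fun x ν => by
    show Real.sin _ = Real.sin _
    rw [phase_add, Real.sin_add_int_mul_two_pi]⟩

lemma D_ec {d : ℕ} (n : Fin d → ℤ) (j : Fin d) :
    SP.D j (ec n) = (-(2 * Real.pi * n j)) • es n := by
  refine SP.ext' fun x => ?_
  rw [SP.D_app, SP.smul_app]
  apply hasDerivAt_pd (SP.diff (ec n))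
  have := (phase_line n x j).cos
  rw [zero_smul, add_zero] at this
  refine HasDerivAt.congr_deriv (f := fun t : ℝ => Real.cos (phase n (x + t • Pi.single j 1))) this ?_
  show _ = _ * Real.sin _
  ring

lemma D_es {d : ℕ} (n : Fin d → ℤ) (j : Fin d) :
    SP.D j (es n) = (2 * Real.pi * n j) • ec n := by
  refine SP.ext' fun x => ?_
  rw [SP.D_app, SP.smul_app]
  apply hasDerivAt_pd (SP.diff (es n))
  have := (phase_line n x j).sin
  rw [zero_smul, add_zero] at this
  refine HasDerivAt.congr_deriv (f := fun t : ℝ => Real.sin (phase n (x + t • Pi.single j 1))) this ?_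
  show _ = _ * Real.cos _
  ring

/-- all modes -/
def emode {d : ℕ} (i : (Fin d → ℤ) × Bool) : SP d := if i.2 then ec i.1 else es i.1

lemma emode_eig {d : ℕ} (i : (Fin d → ℤ) × Bool) (j : Fin d) :
    SP.D j (SP.D j (emode i)) = (-((2 * Real.pi * i.1 j) ^ 2)) • emode i := by
  obtain ⟨n, b⟩ := i
  cases b
  · simp only [emode, Bool.false_eq_true, if_false, D_es, D_ec, map_smul, smul_smul]
    congr 1; ring
  · simp only [emode, if_true, D_es, D_ec, map_smul, smul_smul]
    congr 1; ring

lemma mFourier_app {d : ℕ} (n : Fin d → ℤ) (x : Fin d → ℝ) :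
    UnitAddTorus.mFourier n (fun i => (x i : UnitAddCircle))
      = ⟨Real.cos (phase n x), Real.sin (phase n x)⟩ := by
  have h : UnitAddTorus.mFourier n (fun i => (x i : UnitAddCircle))
      = Complex.exp ((phase n x : ℝ) * Complex.I) := by
    simp only [UnitAddTorus.mFourier, ContinuousMap.coe_mk, fourier_coe_apply]
    rw [← Complex.exp_sum]
    congr 1
    unfold phase
    push_cast
    rw [Finset.sum_mul]
    refine Finset.sum_congr rfl fun i _ => by ring
  rw [h, Complex.exp_mul_I, ← Complex.ofReal_cos, ← Complex.ofReal_sin]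
  apply Complex.ext <;>
    simp only [Complex.add_re, Complex.add_im, Complex.ofReal_re, Complex.ofReal_im, Complex.mul_re,
      Complex.mul_im, Complex.I_re, Complex.I_im] <;> ring

lemma torus_lift {d : ℕ} {w : (Fin d → ℝ) → ℝ} (hw : Continuous w) (pw : Per w) :
    ∃ W : C(UnitAddTorus (Fin d), ℂ), ∀ x : Fin d → ℝ, W (fun i => (x i : UnitAddCircle)) = w x := by
  let W : UnitAddTorus (Fin d) → ℂ := fun z => w (fun i => Quotient.out (z i))
  have hW : ∀ x : Fin d → ℝ, W (fun i => (x i : UnitAddCircle)) = w x := by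
    intro x
    have h : ∀ i, ∃ ν : ℤ, Quotient.out ((x i : UnitAddCircle)) = x i + ν := by
      intro i
      have h1 : ((Quotient.out ((x i : UnitAddCircle)) : ℝ) : UnitAddCircle) = (x i : UnitAddCircle) :=
        QuotientAddGroup.out_eq' _
      rw [← sub_eq_zero, ← AddCircle.coe_sub, AddCircle.coe_eq_zero_iff] at h1
      obtain ⟨k, hk⟩ := h1
      refine ⟨k, ?_⟩
      rw [zsmul_eq_mul, mul_one] at hk
      linarith
    choose ν hν using h
    have : (fun i => Quotient.out ((x i : UnitAddCircle))) = x + fun i => (ν i : ℝ) := funext hν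
    show ((w _ : ℝ) : ℂ) = _
    rw [this, pw]
  have hq : IsOpenQuotientMap (Pi.map (fun (_ : Fin d) (t : ℝ) => (t : UnitAddCircle))) :=
    IsOpenQuotientMap.piMap fun _ => QuotientAddGroup.isOpenQuotientMap_mk
  refine ⟨⟨W, ?_⟩, hW⟩
  rw [hq.isQuotientMap.continuous_iff]
  have : W ∘ (Pi.map (fun (_ : Fin d) (t : ℝ) => (t : UnitAddCircle))) = fun x => (w x : ℂ) :=
    funext hW
  rw [this]
  exact Complex.continuous_ofReal.comp hw

lemma mode_density {d : ℕ} {w : (Fin d → ℝ) → ℝ} (hw : Continuous w) (pw : Per w)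
    (h : ∀ i : (Fin d → ℤ) × Bool, tInt (fun x => w x * emode i x) = 0) (x) : w x = 0 := by
  obtain ⟨W, hW⟩ := torus_lift hw pw
  let π : (Fin d → ℝ) → UnitAddTorus (Fin d) := fun x i => (x i : UnitAddCircle)
  have hπ : Continuous π := continuous_pi fun i => (AddCircle.continuous_mk' 1).comp (continuous_apply i)
  have cre : ∀ P : C(UnitAddTorus (Fin d), ℂ), Continuous fun x => w x * (P (π x)).re := fun P =>
    hw.mul (Complex.continuous_re.comp (P.continuous.comp hπ))
  have cim : ∀ P : C(UnitAddTorus (Fin d), ℂ), Continuous fun x => w x * (P (π x)).im := fun P =>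
    hw.mul (Complex.continuous_im.comp (P.continuous.comp hπ))
  have hspan : ∀ P ∈ Submodule.span ℂ (Set.range (UnitAddTorus.mFourier (d := Fin d))),
      tInt (fun x => w x * (P (π x)).re) = 0 ∧ tInt (fun x => w x * (P (π x)).im) = 0 := by
    intro P hP
    induction hP using Submodule.span_induction with
    | mem P hP =>
      obtain ⟨n, rfl⟩ := hP
      simp only [π, mFourier_app]
      exact ⟨h (n, true), h (n, false)⟩
    | zero => simp [tInt_const]
    | add P Q _ _ hP hQ =>
      simp only [ContinuousMap.add_apply, Complex.add_re, Complex.add_im, mul_add]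
      rw [tInt_add (cre P) (cre Q), tInt_add (cim P) (cim Q), hP.1, hP.2, hQ.1, hQ.2]
      simp
    | smul c P _ hP =>
      have e1 : (fun x => w x * ((c • P) (π x)).re)
          = fun x => c.re * (w x * (P (π x)).re) - c.im * (w x * (P (π x)).im) := by
        ext x; simp; ring
      have e2 : (fun x => w x * ((c • P) (π x)).im)
          = fun x => c.re * (w x * (P (π x)).im) + c.im * (w x * (P (π x)).re) := by
        ext x; simp; ring
      have c1 : ∀ c, Continuous fun x => c * (w x * (P (π x)).re) := fun c =>
        continuous_const.mul (cre P)
      have c2 : ∀ c, Continuous fun x => c * (w x * (P (π x)).im) := fun c =>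
        continuous_const.mul (cim P)
      rw [e1, e2, tInt_sub (c1 _) (c2 _), tInt_add (c2 _) (c1 _)]
      simp only [tInt_const_mul, hP.1, hP.2]
      simp
  obtain ⟨C, hC0, hC⟩ := per_bdd pw hw
  have hww : Continuous fun x => w x * w x := hw.mul hw
  have hle : ∀ ε > 0, tInt (fun x => w x * w x) ≤ C * ε := by
    intro ε hε
    have hcl : W ∈ (Submodule.span ℂ
        (Set.range (UnitAddTorus.mFourier (d := Fin d)))).topologicalClosure := by
      rw [UnitAddTorus.span_mFourier_closure_eq_top]; trivial
    obtain ⟨P, hP, hd⟩ := Metric.mem_closure_iff.1 hcl ε hε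
    have h0 := (hspan P hP).1
    have : tInt (fun x => w x * w x) = tInt (fun x => w x * w x - w x * (P (π x)).re) := by
      rw [tInt_sub hww (cre P), h0, sub_zero]
    rw [this, ← tInt_const (d := d) (C * ε)]
    refine tInt_mono (hww.sub (cre P)) continuous_const fun x => ?_
    have h1 : |w x - (P (π x)).re| ≤ ε := by
      have h2 : dist (W (π x)) (P (π x)) ≤ ε := (ContinuousMap.dist_apply_le_dist _).trans hd.le
      rw [dist_eq_norm] at h2
      have h3 := (Complex.abs_re_le_norm _).trans h2
      rw [Complex.sub_re, hW x] at h3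
      simpa using h3
    calc w x * w x - w x * (P (π x)).re = w x * (w x - (P (π x)).re) := by ring
      _ ≤ |w x * (w x - (P (π x)).re)| := le_abs_self _
      _ = |w x| * |w x - (P (π x)).re| := abs_mul _ _
      _ ≤ C * ε := mul_le_mul (hC x) h1 (abs_nonneg _) hC0
  have hz : tInt (fun x => w x * w x) = 0 := by
    refine le_antisymm ?_ (tInt_nonneg fun x => mul_self_nonneg _)
    refine le_of_forall_pos_le_add fun δ hδ => ?_
    have := hle (δ / (C + 1)) (by positivity)
    have h2 : C * (δ / (C + 1)) ≤ δ := by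
      rw [mul_div_assoc', div_le_iff₀ (by positivity)]; nlinarith
    linarith
  have := tInt_eq_zero (per_mul pw pw) hww (fun x => mul_self_nonneg _) hz x
  exact mul_self_eq_zero.1 this

end Part8

section Part9
open MeasureTheory Matrix Finset Filter Topology
/-! uniform convergence helpers -/

lemma tu_mul_left {d : ℕ} {F : ℕ → (Fin d → ℝ) → ℝ} {G h : (Fin d → ℝ) → ℝ} {C : ℝ}
    (hh : ∀ x, |h x| ≤ C) (hF : TendstoUniformly F G atTop) :
    TendstoUniformly (fun n x => h x * F n x) (fun x => h x * G x) atTop := by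
  rw [Metric.tendstoUniformly_iff] at *
  intro ε hε
  have hC : 0 ≤ C := (abs_nonneg _).trans (hh 0)
  filter_upwards [hF (ε / (C + 1)) (by positivity)] with n hn x
  have h1 := hn x
  rw [Real.dist_eq] at *
  rw [← mul_sub, abs_mul]
  have h2 : (C + 1) * (ε / (C + 1)) = ε := mul_div_cancel₀ _ (by positivity)
  have h3 := abs_nonneg (G x - F n x)
  calc |h x| * |G x - F n x| ≤ (C + 1) * |G x - F n x| :=
        mul_le_mul_of_nonneg_right (by linarith [hh x]) h3
    _ < (C + 1) * (ε / (C + 1)) := mul_lt_mul_of_pos_left h1 (by positivity)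
    _ = ε := h2

lemma tu_seq_mul {d : ℕ} {c : ℕ → ℝ} {c0 : ℝ} {h : (Fin d → ℝ) → ℝ} {C : ℝ}
    (hh : ∀ x, |h x| ≤ C) (hc : Tendsto c atTop (𝓝 c0)) :
    TendstoUniformly (fun n x => c n * h x) (fun x => c0 * h x) atTop := by
  have h1 : TendstoUniformly (fun n (_ : Fin d → ℝ) => c n) (fun _ => c0) atTop := by
    rw [Metric.tendstoUniformly_iff]
    intro ε hε
    filter_upwards [Metric.tendsto_nhds.1 hc ε hε] with n hn x
    rw [dist_comm]; exact hn
  simpa only [mul_comm] using tu_mul_left hh h1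

lemma tu_sq {d : ℕ} {F : ℕ → (Fin d → ℝ) → ℝ} {G : (Fin d → ℝ) → ℝ} {C : ℝ}
    (hb : ∀ n x, |F n x| ≤ C) (hF : TendstoUniformly F G atTop) :
    TendstoUniformly (fun n x => F n x * F n x) (fun x => G x * G x) atTop := by
  have hG : ∀ x, |G x| ≤ C := fun x =>
    le_of_tendsto ((hF.tendsto_at x).abs) (Eventually.of_forall fun n => hb n x)
  rw [Metric.tendstoUniformly_iff] at *
  intro ε hε
  have hC : 0 ≤ C := (abs_nonneg _).trans (hG 0)
  filter_upwards [hF (ε / (2 * C + 1)) (by positivity)] with n hn x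
  have h1 := hn x
  rw [Real.dist_eq] at *
  have e : G x * G x - F n x * F n x = (G x + F n x) * (G x - F n x) := by ring
  rw [e, abs_mul]
  have h4 : |G x + F n x| ≤ 2 * C + 1 := (abs_add_le _ _).trans (by linarith [hG x, hb n x])
  have h3 := abs_nonneg (G x - F n x)
  calc |G x + F n x| * |G x - F n x| ≤ (2 * C + 1) * |G x - F n x| :=
        mul_le_mul_of_nonneg_right h4 h3
    _ < (2 * C + 1) * (ε / (2 * C + 1)) := mul_lt_mul_of_pos_left h1 (by positivity)
    _ = ε := mul_div_cancel₀ _ (by positivity)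

lemma tu_tInt {d : ℕ} {F : ℕ → (Fin d → ℝ) → ℝ} {G : (Fin d → ℝ) → ℝ}
    (hc : ∀ n, Continuous (F n)) (hF : TendstoUniformly F G atTop) :
    Tendsto (fun n => tInt (F n)) atTop (𝓝 (tInt G)) := by
  have hG : Continuous G := hF.continuous (Frequently.of_forall hc)
  rw [Metric.tendsto_nhds]
  intro ε hε
  filter_upwards [Metric.tendstoUniformly_iff.1 hF (ε / 2) (by positivity)] with n hn
  have h1 : tInt (fun x => F n x - G x) ≤ ε / 2 := by
    rw [← tInt_const (d := d) (ε / 2)]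
    refine tInt_mono ((hc n).sub hG) continuous_const fun x => ?_
    have := hn x
    rw [Real.dist_eq, abs_lt] at this
    linarith
  have h2 : -(ε / 2) ≤ tInt (fun x => F n x - G x) := by
    rw [← tInt_const (d := d) (-(ε / 2))]
    refine tInt_mono continuous_const ((hc n).sub hG) fun x => ?_
    have := hn x
    rw [Real.dist_eq, abs_lt] at this
    linarith
  rw [tInt_sub (hc n) hG] at h1 h2
  rw [Real.dist_eq, abs_lt]
  constructor <;> linarith

/-! Galerkin approximation -/

open SP

/-- bilinear form version -/
def ipSL {d m : ℕ} (k : ℕ) : (Fin m → SP d) →ₗ[ℝ] (Fin m → SP d) →ₗ[ℝ] ℝ :=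
  ∑ α, (ip k).compl₁₂ (LinearMap.proj α) (LinearMap.proj α)

lemma ipSL_app {d m : ℕ} (k : ℕ) (u v : Fin m → SP d) : ipSL k u v = ipS k u v := by
  simp [ipSL, ipS, LinearMap.sum_apply]

lemma N0_eq_zero {d : ℕ} {u : SP d} (h : N 0 u = 0) : u = 0 := by
  refine SP.ext' fun x => ?_
  have := tInt_eq_zero (per (u * u)) (cont (u * u)) (fun x => mul_self_nonneg (u x)) h x
  exact mul_self_eq_zero.1 this

lemma NS_smul {d m : ℕ} (k : ℕ) (c : ℝ) (u : Fin m → SP d) : NS k (c • u) = c^2 * NS k u := by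
  simp only [NS, Pi.smul_apply, N_smul, Finset.mul_sum]

lemma galerkin_abs {E : Type} [AddCommGroup E] [Module ℝ E] (B : E →ₗ[ℝ] E →ₗ[ℝ] ℝ)
    (L : E →ₗ[ℝ] E) (f : E) (s : Set E) (hs : s.Finite) :
    ∃ u ∈ Submodule.span ℝ s, ∃ t : ℝ, ¬ (u = 0 ∧ t = 0) ∧
      ∀ v ∈ Submodule.span ℝ s, B (L u - t • f) v = 0 := by
  set V := Submodule.span ℝ s with hV
  have : FiniteDimensional ℝ V := FiniteDimensional.span_of_finite ℝ hs
  let T : (V × ℝ) →ₗ[ℝ] Module.Dual ℝ V :=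
    (V.dualRestrict ∘ₗ B ∘ₗ L ∘ₗ V.subtype).coprod
      (LinearMap.toSpanSingleton ℝ _ (V.dualRestrict (B (-f))))
  have hT : ∀ (u : V) (t : ℝ) (v : V), T (u, t) v = B (L u - t • f) v := by
    intro u t v
    simp [T]
    ring
  have hlt : Module.finrank ℝ (Module.Dual ℝ V) < Module.finrank ℝ (V × ℝ) := by
    rw [Subspace.dual_finrank_eq, Module.finrank_prod, Module.finrank_self]
    omega
  have hker := LinearMap.ker_ne_bot_of_finrank_lt (f := T) hlt
  obtain ⟨⟨u, t⟩, hmem, hne⟩ := Submodule.exists_mem_ne_zero_of_ne_bot hker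
  refine ⟨u, u.2, t, ?_, ?_⟩
  · rintro ⟨h1, h2⟩
    apply hne
    rw [Prod.mk_eq_zero]
    exact ⟨Subtype.ext h1, h2⟩
  · intro v hv
    have := hT u t ⟨v, hv⟩
    rw [LinearMap.mem_ker.1 hmem] at this
    exact this.symm

lemma galerkin {d m : ℕ} (L : (Fin m → SP d) →ₗ[ℝ] (Fin m → SP d)) (f : Fin m → SP d) (k : ℕ)
    (s : Set (Fin m → SP d)) (hs : s.Finite) :
    ∃ (u : Fin m → SP d) (t : ℝ), NS 0 u + t ^ 2 = 1 ∧ ipS k (L u - t • f) u = 0 ∧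
      ∀ v ∈ s, ipS k (L u - t • f) v = 0 := by
  obtain ⟨u, humem, t, hne, h0⟩ := galerkin_abs (ipSL k) L f s hs
  have hS : 0 < NS 0 u + t ^ 2 := by
    have h1 := NS_nonneg 0 u
    rcases (add_nonneg h1 (sq_nonneg t)).lt_or_eq with h | h
    · exact h
    · exfalso
      apply hne
      have ht : t = 0 := by
        have : t ^ 2 = 0 := by linarith [sq_nonneg t]
        simpa using this
      have hu : NS 0 u = 0 := by linarith [sq_nonneg t]
      unfold NS at hu
      rw [Finset.sum_eq_zero_iff_of_nonneg fun _ _ => N_nonneg _ _] at hu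
      have hu' : u = 0 := funext fun α => N0_eq_zero (hu α (Finset.mem_univ _))
      exact ⟨hu', ht⟩
  set S := NS 0 u + t ^ 2 with hSdef
  have hr : (Real.sqrt S)⁻¹ ^ 2 * S = 1 := by
    rw [inv_pow, Real.sq_sqrt hS.le, inv_mul_cancel₀ hS.ne']
  set r := (Real.sqrt S)⁻¹ with hrdef
  have e : L (r • u) - (r * t) • f = r • (L u - t • f) := by
    rw [map_smul, smul_sub, mul_smul]
  refine ⟨r • u, r * t, ?_, ?_, ?_⟩
  · rw [NS_smul, mul_pow, ← mul_add]; exact hr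
  · rw [e, ← ipSL_app, map_smul (ipSL k), LinearMap.smul_apply,
      h0 _ (Submodule.smul_mem _ _ humem), smul_zero]
  · intro v hv
    rw [e, ← ipSL_app, map_smul, LinearMap.smul_apply, h0 _ (Submodule.subset_span hv), smul_zero]

lemma galerkin_bound {d m : ℕ} (b : Fin m → Fin d → SP d) (a : Fin m → Fin d → Fin d → SP d)
    (q : Fin m → Fin m → SP d) {amin : ℝ} (ham : 0 < amin)
    (hell : ∀ α (x ξ : Fin d → ℝ), amin * ∑ i, ξ i ^ 2 ≤ ∑ j, ∑ k, a α j k x * (ξ j * ξ k))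
    (k : ℕ) (f : Fin m → SP d) : ∃ R, ∀ (u : Fin m → SP d) (t : ℝ), NS 0 u + t ^ 2 = 1 →
      ipS k (Lop b a q u - t • f) u = 0 → NS (k+1) u ≤ R := by
  obtain ⟨c, C, hc, hC, h⟩ := gardingS b a q ham hell k
  refine ⟨(2 / c) * (C + 1 / (2 * c) * NS k f), fun u t h1 h2 => ?_⟩
  have g1 := h u
  have e : ipS k (Lop b a q u) u = t * ipS k f u := by
    rw [← ipSL_app] at *
    rw [map_sub, LinearMap.sub_apply, map_smul, LinearMap.smul_apply, smul_eq_mul, sub_eq_zero] at h2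
    rw [h2, ipSL_app]
  have hu1 : NS 0 u ≤ 1 := by linarith [sq_nonneg t]
  have ht1 : t ^ 2 ≤ 1 := by linarith [NS_nonneg 0 u]
  have g2 : -(t * ipS k f u) ≤ c / 2 * NS k u + 1 / (2 * c) * NS k f := by
    unfold ipS NS
    rw [Finset.mul_sum, Finset.mul_sum, Finset.mul_sum, ← Finset.sum_neg_distrib,
      ← Finset.sum_add_distrib]
    refine Finset.sum_le_sum fun α _ => ?_
    have y := young k (half_pos hc) (u α) ((-t) • f α)
    rw [map_smul, smul_eq_mul, N_smul, ip_symm] at y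
    have y2 : 1 / (4 * (c / 2)) * ((-t) ^ 2 * N k (f α)) ≤ 1 / (2 * c) * N k (f α) := by
      have : 4 * (c / 2) = 2 * c := by ring
      rw [this]
      refine mul_le_mul_of_nonneg_left ?_ (by positivity)
      have := N_nonneg k (f α)
      nlinarith
    linarith
  have g3 : NS k u ≤ NS (k+1) u := Finset.sum_le_sum fun α _ => N_mono1 _ _
  have g4 : C * NS 0 u ≤ C := by nlinarith [NS_nonneg 0 u]
  have g5 : c / 2 * NS k u ≤ c / 2 * NS (k+1) u := mul_le_mul_of_nonneg_left g3 (half_pos hc).le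
  have g6 : c / 2 * NS (k+1) u ≤ C + 1 / (2 * c) * NS k f := by rw [e] at g1; linarith
  have := mul_le_mul_of_nonneg_left g6 (show 0 ≤ 2 / c by positivity)
  have e2 : 2 / c * (c / 2 * NS (k+1) u) = NS (k+1) u := by field_simp
  linarith

/-- Galerkin basis -/
def gb {d m : ℕ} (i : Fin m × ((Fin d → ℤ) × Bool)) : Fin m → SP d := Pi.single i.1 (emode i.2)

lemma ipS_gb {d m : ℕ} (k : ℕ) (w : Fin m → SP d) (i : Fin m × ((Fin d → ℤ) × Bool))
    (h : ipS k w (gb i) = 0) : I (w i.1 * emode i.2) = 0 := by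
  unfold ipS gb at h
  rw [Finset.sum_eq_single i.1] at h
  · rw [Pi.single_eq_same, ip_eig _ k _ _ (emode_eig i.2)] at h
    exact (mul_eq_zero.1 h).resolve_left (mu_pos _ _).ne'
  · intro α _ hα
    rw [Pi.single_eq_of_ne hα, map_zero]
  · simp

lemma galerkin_seq {d m : ℕ} (b : Fin m → Fin d → SP d) (a : Fin m → Fin d → Fin d → SP d)
    (q : Fin m → Fin m → SP d) {amin : ℝ} (ham : 0 < amin)
    (hell : ∀ α (x ξ : Fin d → ℝ), amin * ∑ i, ξ i ^ 2 ≤ ∑ j, ∑ k, a α j k x * (ξ j * ξ k))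
    (f : Fin m → SP d) : ∃ (u : ℕ → Fin m → SP d) (t : ℕ → ℝ) (C : ℝ),
      (∀ n, NS 0 (u n) + t n ^ 2 = 1) ∧
      (∀ α i, ∀ᶠ n in atTop, I ((Lop b a q (u n) - t n • f) α * emode i) = 0) ∧
      (∀ n α x, |u n α x| ≤ C) ∧ (∀ n α i x, |D i (u n α) x| ≤ C) ∧
      (∀ n α i j x, |D j (D i (u n α)) x| ≤ C) ∧
      (∀ n α i j l x, |D l (D j (D i (u n α))) x| ≤ C) := by
  obtain ⟨R, hR⟩ := galerkin_bound b a q ham hell (d + 2) f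
  have : Encodable (Fin m × ((Fin d → ℤ) × Bool)) := Encodable.ofCountable _
  have hfin : ∀ n : ℕ, (gb '' {i : Fin m × ((Fin d → ℤ) × Bool) | Encodable.encode i ≤ n}).Finite :=
    fun n => ((Set.finite_Iic n).preimage Encodable.encode_injective.injOn).image _
  choose u t h1 h2 h3 using fun n => galerkin (Lop b a q) f (d + 2) _ (hfin n)
  have hN : ∀ n α, N (d + 3) (u n α) ≤ R := fun n α =>
    (Finset.single_le_sum (f := fun α => N (d+3) (u n α)) (fun α _ => N_nonneg _ _)
      (Finset.mem_univ α)).trans (hR (u n) (t n) (h1 n) (h2 n))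
  have hsup : ∀ (v : SP d) (x : Fin d → ℝ), N d v ≤ R → |v x| ≤ Real.sqrt (4 ^ d * R) := by
    intro v x hv
    apply Real.abs_le_sqrt
    exact (sob v x).trans (mul_le_mul_of_nonneg_left hv (by positivity))
  refine ⟨u, t, Real.sqrt (4 ^ d * R), h1, ?_, ?_, ?_, ?_, ?_⟩
  · intro α i
    filter_upwards [eventually_ge_atTop (Encodable.encode (α, i))] with n hn
    exact ipS_gb (d + 2) _ (α, i) (h3 n _ ⟨(α, i), hn, rfl⟩)
  · intro n α x
    exact hsup _ _ ((N_mono (by omega) _).trans (hN n α))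
  · intro n α i x
    exact hsup _ _ ((N_D _ _ _).trans ((N_mono (by omega) _).trans (hN n α)))
  · intro n α i j x
    exact hsup _ _ ((N_D _ _ _).trans ((N_D _ _ _).trans ((N_mono (by omega) _).trans (hN n α))))
  · intro n α i j l x
    exact hsup _ _ ((N_D _ _ _).trans ((N_D _ _ _).trans ((N_D _ _ _).trans (hN n α))))

lemma Lop_app {d m : ℕ} (b : Fin m → Fin d → SP d) (a : Fin m → Fin d → Fin d → SP d)
    (q : Fin m → Fin m → SP d) (f : Fin m → SP d) (t : ℝ) (u : Fin m → SP d) (α x) :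
    (Lop b a q u - t • f) α x = (∑ j, b α j x * D j (u α) x)
      + (1/2) * (∑ j, ∑ k, a α j k x * D k (D j (u α)) x) + (∑ β, q α β x * u β x)
      - (∑ β, I (u β)) * 1 - t * f α x := by
  show (∑ j, b α j * D j (u α) + (1/2 : ℝ) • Pr (a α) (u α) + ∑ β, q α β * u β
    - (∑ β, I (u β)) • (1 : SP d) - t • f α) x = _
  simp only [Pr, add_app, sub_app, smul_app, sum_app, mul_app, one_app]

lemma exist_aux {d m : ℕ} (b : Fin m → Fin d → SP d) (a : Fin m → Fin d → Fin d → SP d)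
    (q : Fin m → Fin m → SP d) {amin : ℝ} (ham : 0 < amin)
    (hell : ∀ α (x ξ : Fin d → ℝ), amin * ∑ i, ξ i ^ 2 ≤ ∑ j, ∑ k, a α j k x * (ξ j * ξ k))
    (f : Fin m → SP d) : ∃ (u : Fin m → (Fin d → ℝ) → ℝ) (t : ℝ),
      (∀ α, ContDiff ℝ 2 (u α)) ∧ (∀ α, Per (u α)) ∧
      (∑ α, tInt (fun x => u α x * u α x)) + t ^ 2 = 1 ∧
      ∀ α x, (∑ j, b α j x * pd (u α) j x)
        + (1/2) * (∑ j, ∑ k, a α j k x * pd2 (u α) j k x) + (∑ β, q α β x * u β x)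
        - (∑ β, tInt (u β)) = t * f α x := by
  obtain ⟨u, t, C, hn, htest, B0, B1, B2, B3⟩ := galerkin_seq b a q ham hell f
  let g : ℕ → Fin m × (Unit ⊕ Fin d ⊕ (Fin d × Fin d)) → SP d := fun n J =>
    match J with
    | (α, Sum.inl _) => u n α
    | (α, Sum.inr (Sum.inl i)) => D i (u n α)
    | (α, Sum.inr (Sum.inr (i, j))) => D j (D i (u n α))
  obtain ⟨θ, hθ, G, hG⟩ := arzela g C
    (by rintro n ⟨α, _ | i | ⟨i, j⟩⟩ x
        · exact B0 n α x
        · exact B1 n α i x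
        · exact B2 n α i j x)
    (by rintro n ⟨α, _ | i | ⟨i, j⟩⟩ l x
        · exact B1 n α l x
        · exact B2 n α i l x
        · exact B3 n α i j l x)
  have htb : ∀ n, t n ∈ Set.Icc (-1:ℝ) 1 := by
    intro n
    have := hn n
    have h2 := NS_nonneg 0 (u n)
    exact ⟨by nlinarith, by nlinarith⟩
  obtain ⟨t0, -, θ2, hθ2, ht0⟩ := isCompact_Icc.tendsto_subseq fun n => htb (θ n)
  set ψ : ℕ → ℕ := fun n => θ (θ2 n) with hψ
  have hψt : Tendsto ψ atTop atTop := hθ.tendsto_atTop.comp hθ2.tendsto_atTop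
  have hG' : ∀ J, TendstoUniformly (fun n => (g (ψ n) J).1) (G J) atTop := fun J s hs =>
    hθ2.tendsto_atTop.eventually (hG J s hs)
  set U : Fin m → (Fin d → ℝ) → ℝ := fun α => G (α, Sum.inl ()) with hU
  have T0 : ∀ α, TendstoUniformly (fun n => (u (ψ n) α).1) (U α) atTop := fun α =>
    hG' (α, Sum.inl ())
  have hlim : ∀ α, ContDiff ℝ 2 (U α) ∧ Per (U α) ∧
      (∀ i, pd (U α) i = G (α, Sum.inr (Sum.inl i))) ∧
      (∀ i j, pd2 (U α) i j = G (α, Sum.inr (Sum.inr (i, j)))) := fun α =>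
    c2_limit (fun n => u (ψ n) α) (U α) (fun i => G (α, Sum.inr (Sum.inl i)))
      (fun i j => G (α, Sum.inr (Sum.inr (i, j)))) (T0 α)
      (fun i => hG' (α, Sum.inr (Sum.inl i)))
      (fun i j => hG' (α, Sum.inr (Sum.inr (i, j))))
  have T1 : ∀ α i, TendstoUniformly (fun n => (D i (u (ψ n) α)).1) (pd (U α) i) atTop := fun α i => by
    rw [(hlim α).2.2.1 i]; exact hG' (α, Sum.inr (Sum.inl i))
  have T2 : ∀ α i j, TendstoUniformly (fun n => (D j (D i (u (ψ n) α))).1) (pd2 (U α) i j) atTop :=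
    fun α i j => by
      rw [(hlim α).2.2.2 i j]; exact hG' (α, Sum.inr (Sum.inr (i, j)))
  have htψ : Tendsto (fun n => t (ψ n)) atTop (𝓝 t0) := ht0
  have hIlim : Tendsto (fun n => ∑ β, I (u (ψ n) β)) atTop (𝓝 (∑ β, tInt (U β))) :=
    tendsto_finsetSum _ fun β _ => tu_tInt (fun n => cont (u (ψ n) β)) (T0 β)
  have smul_bdd : ∀ (h : SP d) {F : ℕ → (Fin d → ℝ) → ℝ} {H : (Fin d → ℝ) → ℝ},
      TendstoUniformly F H atTop →
      TendstoUniformly (fun n x => h x * F n x) (fun x => h x * H x) atTop := by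
    intro h F H hF
    obtain ⟨C, -, hC⟩ := sup_bdd h
    exact tu_mul_left hC hF
  refine ⟨U, t0, fun α => (hlim α).1, fun α => (hlim α).2.1, ?_, ?_⟩
  · have h1 : Tendsto (fun n => NS 0 (u (ψ n)) + t (ψ n) ^ 2) atTop
        (𝓝 ((∑ α, tInt (fun x => U α x * U α x)) + t0 ^ 2)) := by
      refine Tendsto.add (tendsto_finsetSum _ fun α _ => ?_) (htψ.pow 2)
      exact tu_tInt (fun n => cont (u (ψ n) α * u (ψ n) α)) (tu_sq (fun n x => B0 (ψ n) α x) (T0 α))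
    simp only [hn] at h1
    exact (tendsto_nhds_unique h1 tendsto_const_nhds)
  · intro α x
    set W : (Fin d → ℝ) → ℝ := fun x => (∑ j, b α j x * pd (U α) j x)
        + (1/2) * (∑ j, ∑ k, a α j k x * pd2 (U α) j k x) + (∑ β, q α β x * U β x)
        - (∑ β, tInt (U β)) * 1 - t0 * f α x with hW
    have hWlim : TendstoUniformly (fun n => ((Lop b a q (u (ψ n)) - t (ψ n) • f) α).1) W atTop := by
      have e : (fun n => ((Lop b a q (u (ψ n)) - t (ψ n) • f) α).1) = fun n x =>
        (∑ j, b α j x * D j (u (ψ n) α) x)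
        + (1/2) * (∑ j, ∑ k, a α j k x * D k (D j (u (ψ n) α)) x) + (∑ β, q α β x * u (ψ n) β x)
        - (∑ β, I (u (ψ n) β)) * 1 - t (ψ n) * f α x := by
        ext n x; exact Lop_app b a q f _ _ α x
      rw [e, hW]
      obtain ⟨Cf, -, hCf⟩ := sup_bdd (f α)
      refine TendstoUniformly.fun_sub (TendstoUniformly.fun_sub (TendstoUniformly.fun_add
        (TendstoUniformly.fun_add ?_ ?_) ?_) ?_) ?_
      · exact tu_sum _ _ _ fun j _ => smul_bdd (b α j) (T1 α j)
      · refine tu_mul_left (h := fun _ => 1/2) (C := |1/2|) (fun _ => le_rfl) ?_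
        exact tu_sum _ _ _ fun j _ => tu_sum _ _ _ fun k _ => smul_bdd (a α j k) (T2 α j k)
      · exact tu_sum _ _ _ fun β _ => smul_bdd (q α β) (T0 β)
      · exact tu_seq_mul (h := fun _ => 1) (C := |1|) (fun _ => le_rfl) hIlim
      · exact tu_seq_mul hCf htψ
    have hWc : Continuous W := hWlim.continuous (Frequently.of_forall fun n => cont _)
    have hWp : Per W := by
      intro x ν
      refine tendsto_nhds_unique (hWlim.tendsto_at _) ?_
      refine (hWlim.tendsto_at x).congr fun n => ?_
      exact (per ((Lop b a q (u (ψ n)) - t (ψ n) • f) α) x ν).symm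
    have hz : W x = 0 := by
      refine mode_density hWc hWp (fun i => ?_) x
      have h1 := smul_bdd (emode i) hWlim
      have h2 := tu_tInt (fun n => cont (emode i * (Lop b a q (u (ψ n)) - t (ψ n) • f) α)) h1
      have h3 : Tendsto (fun n => tInt (emode i * (Lop b a q (u (ψ n)) - t (ψ n) • f) α).1) atTop
          (𝓝 0) := by
        refine tendsto_const_nhds.congr' ?_
        filter_upwards [hψt.eventually (htest α i)] with n hn
        rw [mul_comm]; exact hn.symm
      have h4 := tendsto_nhds_unique h2 h3
      rw [← h4]
      congr 1; ext x; ring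
    rw [hW] at hz
    simp only at hz
    linarith

end Part9

lemma gen_sub_smul {d r m : ℕ}
    {b : (Fin d → ℝ) → Fin m → Fin d → ℝ}
    {σ : (Fin d → ℝ) → Fin m → Matrix (Fin d) (Fin r) ℝ}
    {q : Fin m → Fin m → (Fin d → ℝ) → ℝ} (ε : ℝ)
    {Φ Ψ : (Fin d → ℝ) → Fin m → ℝ}
    (h1 : ∀ α, ContDiff ℝ 2 fun x => Φ x α) (h2 : ∀ α, ContDiff ℝ 2 fun x => Ψ x α) (x α) :
    gen b (diffMat σ) q (fun y β => Φ y β - ε * Ψ y β) x α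
      = gen b (diffMat σ) q Φ x α - ε * gen b (diffMat σ) q Ψ x α := by
  rw [gen_eq_Sop, gen_eq_Sop, gen_eq_Sop, Sop_sub _ _ ε (h1 α) (h2 α)]
  have : jumpOp q (fun y β => Φ y β - ε * Ψ y β) x α
      = jumpOp q Φ x α - ε * jumpOp q Ψ x α := by
    unfold jumpOp
    rw [Finset.mul_sum, ← Finset.sum_sub_distrib]
    refine Finset.sum_congr rfl fun β _ => ?_
    ring
  rw [this]; ring

/-- Fredholm alternative / solvability of the cell-type problem.
There is a unique `C²`, `1`-periodic, mean-zero solution `Φ` of `ℒΦ = φ`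
iff the centering condition `∑_α ∫_{𝕋^d} φ(x,α) m(x,α) dx = 0` holds. -/
theorem fredholm_alternative
    {d r m : ℕ} (hd : 0 < d) (hr : 0 < r) (hm : 0 < m)
    (b : (Fin d → ℝ) → Fin m → Fin d → ℝ)
    (σ : (Fin d → ℝ) → Fin m → Matrix (Fin d) (Fin r) ℝ)
    (q : Fin m → Fin m → (Fin d → ℝ) → ℝ)
    (amin qbar : ℝ) (hamin : 0 < amin)
    (hb : ∀ α j, ContDiff ℝ (⊤ : ℕ∞) fun x => b x α j)
    (hσ : ∀ α i j, ContDiff ℝ (⊤ : ℕ∞) fun x => σ x α i j)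
    (hell : ∀ (x ξ : Fin d → ℝ) (α : Fin m),
      amin * ∑ i, ξ i ^ 2 ≤ ξ ⬝ᵥ (diffMat σ x α *ᵥ ξ))
    (hq_smooth : ∀ α β, α ≠ β → ContDiff ℝ (⊤ : ℕ∞) (q α β))
    (hq_nonneg : ∀ α β, α ≠ β → ∀ x, 0 ≤ q α β x)
    (hq_bdd : ∀ α β, α ≠ β → ∀ x, q α β x ≤ qbar)
    (hq_diag : ∀ α x, q α α x = -∑ β ∈ Finset.univ.filter (fun β => β ≠ α), q α β x)
    (hq_irred : ∀ (x : Fin d → ℝ) (B : Set (Fin m)), B.Nonempty → Bᶜ.Nonempty →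
      ∃ α ∈ B, ∃ β ∈ Bᶜ, q α β x ≠ 0)
    (hb_per : ∀ α j, Per fun x => b x α j)
    (hσ_per : ∀ α i j, Per fun x => σ x α i j)
    (hq_per : ∀ α β, Per (q α β))
    (M : (Fin d → ℝ) → Fin m → ℝ)
    (hM_nonneg : ∀ x α, 0 ≤ M x α)
    (hM_C2 : ∀ α, ContDiff ℝ 2 fun x => M x α)
    (hM_per : ∀ α, Per fun x => M x α)
    (hM_inv : ∀ x α, genAdj b (diffMat σ) q M x α = 0)
    (hM_norm : (∑ α, tInt fun x => M x α) = 1)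
    (φ : (Fin d → ℝ) → Fin m → ℝ)
    (hφ : ∀ α, ContDiff ℝ (⊤ : ℕ∞) fun x => φ x α)
    (hφ_per : ∀ α, Per fun x => φ x α) :
    (∃! Φ : (Fin d → ℝ) → Fin m → ℝ,
        (∀ α, ContDiff ℝ 2 fun x => Φ x α) ∧
        (∀ x α, gen b (diffMat σ) q Φ x α = φ x α) ∧
        (∀ α, Per fun x => Φ x α) ∧
        (∑ α, tInt fun x => Φ x α) = 0) ↔
      (∑ α, tInt fun x => φ x α * M x α) = 0 := by
  have top2 : (2 : WithTop ℕ∞) ≤ ((⊤ : ℕ∞) : WithTop ℕ∞) := by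
    exact WithTop.coe_le_coe.2 (le_top (a := (2 : ℕ∞)))
  have ha : ∀ α i j, ContDiff ℝ (⊤ : ℕ∞) fun x => diffMat σ x α i j := by
    intro α i j
    simp only [diffMat, Matrix.mul_apply, Matrix.transpose_apply]
    exact ContDiff.sum fun k _ => (hσ α i k).mul (hσ α j k)
  have ha_per : ∀ α i j, Per fun x => diffMat σ x α i j := by
    intro α i j x ν
    simp only [diffMat, Matrix.mul_apply, Matrix.transpose_apply]
    refine Finset.sum_congr rfl fun k _ => ?_
    have h1 := hσ_per α i k x ν
    have h2 := hσ_per α j k x ν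
    simp only at h1 h2
    rw [h1, h2]
  have hq : ∀ α β, ContDiff ℝ (⊤ : ℕ∞) (q α β) := by
    intro α β
    by_cases h : α = β
    · subst h
      rw [show q α α = fun x => -∑ β ∈ Finset.univ.filter (fun β => β ≠ α), q α β x from
        funext (hq_diag α)]
      exact (ContDiff.sum fun β hβ => hq_smooth α β (Finset.mem_filter.1 hβ).2.symm).neg
    · exact hq_smooth α β h
  have dual : ∀ Φ : (Fin d → ℝ) → Fin m → ℝ, (∀ α, ContDiff ℝ 2 fun x => Φ x α) →
      (∀ α, Per fun x => Φ x α) →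
      ∑ α, tInt (fun x => gen b (diffMat σ) q Φ x α * M x α) = 0 := by
    intro Φ h1 h2
    rw [duality b (diffMat σ) q (fun α j => (hb α j).of_le top2)
      (fun α i j => (ha α i j).of_le top2) (fun α β => (hq α β).continuous) hq_diag hb_per ha_per
      M Φ hM_C2 hM_per h1 h2]
    refine Finset.sum_eq_zero fun α _ => ?_
    simp only [hM_inv, mul_zero]
    exact tInt_const 0
  have zero : ∀ Φ : (Fin d → ℝ) → Fin m → ℝ, (∀ α, ContDiff ℝ 2 fun x => Φ x α) →
      (∀ α, Per fun x => Φ x α) → (∀ x α, gen b (diffMat σ) q Φ x α = 0) →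
      (∑ α, tInt fun x => Φ x α) = 0 → ∀ x α, Φ x α = 0 := by
    intro Φ h1 h2 h3 h4
    obtain ⟨c, hc⟩ := gen_const hm b σ q amin hamin (fun α j => (hb α j).continuous)
      (fun α i j => (hσ α i j).continuous) hell (fun α β _ => (hq α β).continuous)
      hq_nonneg hq_irred Φ h1 h2 h3
    have hm' : (m : ℝ) ≠ 0 := by exact_mod_cast hm.ne'
    simp only [hc, tInt_const, Finset.sum_const, Finset.card_univ, Fintype.card_fin,
      nsmul_eq_mul] at h4
    intro x α
    rw [hc]
    exact (mul_eq_zero.1 h4).resolve_left hm'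
  constructor
  · rintro ⟨Φ, ⟨h1, h2, h3, -⟩, -⟩
    have := dual Φ h1 h3
    simpa only [h2] using this
  · intro hcent
    obtain ⟨u, t, hu2, huper, hnorm, heq⟩ := exist_aux
      (fun α j => (⟨fun x => b x α j, hb α j, hb_per α j⟩ : SP d))
      (fun α i j => (⟨fun x => diffMat σ x α i j, ha α i j, ha_per α i j⟩ : SP d))
      (fun α β => (⟨q α β, hq α β, hq_per α β⟩ : SP d)) hamin
      (by
        intro α x ξ
        refine (hell x ξ α).trans (le_of_eq ?_)
        simp only [dotProduct, Matrix.mulVec, Finset.mul_sum]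
        refine Finset.sum_congr rfl fun j _ => Finset.sum_congr rfl fun k _ => ?_
        ring)
      (fun α => (⟨fun x => φ x α, hφ α, hφ_per α⟩ : SP d))
    set U : (Fin d → ℝ) → Fin m → ℝ := fun x α => u α x with hU
    have hgen : ∀ x α, gen b (diffMat σ) q U x α = (∑ β, tInt (u β)) + t * φ x α := by
      intro x α
      have := heq α x
      rw [gen, jumpOp_eq hq_diag]
      simp only [hU]
      simp only at this
      linarith
    have hmean : (∑ β, tInt (u β)) = 0 := by
      have h := dual U hu2 huper
      simp only [hgen] at h
      have e : ∀ α, tInt (fun x => ((∑ β, tInt (u β)) + t * φ x α) * M x α)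
          = (∑ β, tInt (u β)) * tInt (fun x => M x α) + t * tInt (fun x => φ x α * M x α) := by
        intro α
        rw [← tInt_const_mul, ← tInt_const_mul, ← tInt_add
          (f := fun x => (∑ β, tInt (u β)) * M x α) (g := fun x => t * (φ x α * M x α))
          (continuous_const.mul (hM_C2 α).continuous)
          (continuous_const.mul ((hφ α).continuous.mul (hM_C2 α).continuous))]
        congr 1; ext x; ring
      simp only [e, Finset.sum_add_distrib, ← Finset.mul_sum, hM_norm, hcent] at h
      linarith
    have hgen' : ∀ x α, gen b (diffMat σ) q U x α = t * φ x α := by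
      intro x α; rw [hgen, hmean, zero_add]
    have ht : t ≠ 0 := by
      rintro rfl
      have hz := zero U hu2 huper (fun x α => by rw [hgen', zero_mul]) hmean
      have : ∀ α, tInt (fun x => u α x * u α x) = 0 := by
        intro α
        have : (fun x => u α x * u α x) = fun _ => 0 := by
          ext x
          have := hz x α
          simp only [hU] at this
          rw [this, zero_mul]
        rw [this, tInt_const]
      simp [this] at hnorm
    have gz : ∀ x α, gen b (diffMat σ) q (fun _ _ => 0) x α = 0 := by
      intro x α
      rw [gen_eq_Sop]
      unfold Sop pd2 jumpOp
      simp [pd_const]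
    refine existsUnique_of_exists_of_unique
      ⟨fun x α => 0 - (-t⁻¹) * U x α, ?_, ?_, ?_, ?_⟩ ?_
    · intro α
      exact contDiff_const.sub (contDiff_const.mul (hu2 α))
    · intro x α
      rw [gen_sub_smul (Φ := fun _ _ => 0) (Ψ := U) (-t⁻¹) (fun _ => contDiff_const) hu2, gz, hgen']
      field_simp
      ring
    · intro α x ν
      have := huper α x ν
      simp only [hU]
      rw [this]
    · have e : ∀ α, tInt (fun x => 0 - (-t⁻¹) * U x α) = t⁻¹ * tInt (u α) := by
        intro α
        rw [← tInt_const_mul]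
        congr 1; ext x; simp only [hU]; ring
      simp only [e, ← Finset.mul_sum, hmean, mul_zero]
    · rintro Φ Ψ ⟨h1, h2, h3, h4⟩ ⟨k1, k2, k3, k4⟩
      have := zero (fun x α => Φ x α - 1 * Ψ x α)
        (fun α => (h1 α).sub (contDiff_const.mul (k1 α)))
        (fun α x ν => by
          have e1 := h3 α x ν
          have e2 := k3 α x ν
          simp only at e1 e2 ⊢
          rw [e1, e2])
        (fun x α => by rw [gen_sub_smul 1 h1 k1, h2, k2]; ring)
        (by
          have e : ∀ α, tInt (fun x => Φ x α - 1 * Ψ x α)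
              = tInt (fun x => Φ x α) - tInt (fun x => Ψ x α) := by
            intro α
            rw [← tInt_sub (h1 α).continuous (k1 α).continuous]
            simp only [one_mul]
          simp only [e, Finset.sum_sub_distrib, h4, k4, sub_zero])
      funext x α
      have h := this x α
      simp only [one_mul] at h
      linarith
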